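/- Let h ∈ 𝒞, let φ ∈ C¹(S^{n-1}), and let (c_ij) denote the cofactor matrix of (h_ij + h δ_ij). If ∫_{S^{n-1}} φ det(h_ij + h δ_ij) dℋ^{n-1} = 0, then ∫_{S^{n-1}} tr(c_ij) φ² dℋ^{n-1} ≤ ∫_{S^{n-1}} Σ_{i,j=1}^{n-1} c_ij φ_i φ_j dℋ^{n-1}. -/

import Mathlib

open MeasureTheory Metric
open scoped RealInnerProductSpace ENNReal

noncomputable section

/-- Euclidean `n`-space. -/
abbrev E (n : ℕ) : Type := EuclideanSpace ℝ (Fin n)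

/-- Orthogonal projection onto the tangent space `u^⊥` of the sphere at a unit vector `u`. -/
noncomputable def tproj {n : ℕ} (u : E n) : E n →L[ℝ] E n :=
  ContinuousLinearMap.id ℝ (E n) - (innerSL ℝ u).smulRight u

/-- The second derivative of `h` at `u` as an endomorphism of `ℝⁿ`.  For a function on the
sphere, identified with its `1`-homogeneous extension, its restriction to the tangent space
`u^⊥` is represented in any orthonormal frame by the matrix `(h_ij + h δ_ij)`. -/
noncomputable def sHess {n : ℕ} (h : E n → ℝ) (u : E n) : E n →L[ℝ] E n :=
  fderiv ℝ (gradient h) u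

/-- `det(h_ij + h δ_ij)(u)`: the determinant of the restriction of `sHess h u` to the
tangent space `u^⊥` (realized by making the operator the identity in the normal
direction `u`). -/
noncomputable def sdet {n : ℕ} (h : E n → ℝ) (u : E n) : ℝ :=
  LinearMap.det
    (((tproj u).comp ((sHess h u).comp (tproj u)) + (innerSL ℝ u).smulRight u :
      E n →L[ℝ] E n) : E n →ₗ[ℝ] E n)

/-- Positive `1`-homogeneity; functions on the sphere are identified with their
`1`-homogeneous extensions. -/
def homog1 {n : ℕ} (h : E n → ℝ) : Prop := ∀ t : ℝ, 0 < t → ∀ x : E n, h (t • x) = t * h x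

/-- `h ∈ 𝒞`: (the `1`-homogeneous extension of) a function of class `C²` on the sphere
such that the matrix `(h_ij + h δ_ij)` is positive definite at every point of the sphere. -/
def memC (n : ℕ) (h : E n → ℝ) : Prop :=
  homog1 h ∧ ContDiffOn ℝ 2 h {(0 : E n)}ᶜ ∧
    ∀ u ∈ sphere (0 : E n) 1, ∀ v ∈ (ℝ ∙ u)ᗮ, v ≠ 0 → 0 < ⟪sHess h u v, v⟫

open Pointwise in
/-- One-dimensional Brunn–Minkowski inequality for midpoints. -/
theorem volume_add_le_two_mul_volume_midpoints {A B C : Set ℝ} (hA : MeasurableSet A)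
    (hB : MeasurableSet B) (hAn : A.Nonempty) (hBn : B.Nonempty)
    (hC : ∀ a ∈ A, ∀ b ∈ B, (a + b) / 2 ∈ C) :
    volume A + volume B ≤ 2 * volume C := by
  have compact_case : ∀ K L : Set ℝ, IsCompact K → IsCompact L → K.Nonempty → L.Nonempty →
      K ⊆ A → L ⊆ B → volume K + volume L ≤ 2 * volume C := by
    intro K L hK hL hKn hLn hKA hLB
    obtain ⟨a, haK, ha⟩ := hK.exists_isGreatest hKn
    obtain ⟨b, hbL, hb⟩ := hL.exists_isLeast hLn
    have hsub : (fun x : ℝ => x + b) '' K ∪ (fun x : ℝ => x + a) '' L ⊆ (2 : ℝ) • C := by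
      rintro _ (⟨x, hx, rfl⟩ | ⟨x, hx, rfl⟩)
      · exact ⟨(x + b) / 2, hC _ (hKA hx) _ (hLB hbL), by simp; ring⟩
      · exact ⟨(a + x) / 2, hC _ (hKA haK) _ (hLB hx), by simp; ring⟩
    have hinter : volume ((fun x : ℝ => x + b) '' K ∩ (fun x : ℝ => x + a) '' L) = 0 := by
      refine measure_mono_null (t := {a + b}) ?_ (by simp)
      rintro _ ⟨⟨x, hx, rfl⟩, ⟨y, hy, hxy⟩⟩
      have h1 := ha hx
      have h2 := hb hy
      simp only at hxy
      simp only [Set.mem_singleton_iff]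
      linarith
    have hLm : MeasurableSet ((fun x : ℝ => x + a) '' L) :=
      (hL.image (by fun_prop)).measurableSet
    have hun := measure_union_add_inter (μ := volume) ((fun x : ℝ => x + b) '' K) hLm
    rw [hinter, add_zero] at hun
    have e1 : volume ((fun x : ℝ => x + b) '' K) = volume K := by
      simp [Set.image_add_right]
    have e2 : volume ((fun x : ℝ => x + a) '' L) = volume L := by
      simp [Set.image_add_right]
    rw [e1, e2] at hun
    rw [← hun]
    refine (measure_mono hsub).trans (le_of_eq ?_)
    rw [Measure.addHaar_smul]
    simp
  obtain ⟨a₀, ha₀⟩ := hAn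
  obtain ⟨b₀, hb₀⟩ := hBn
  refine le_of_forall_lt fun r hr => ?_
  have hr' : r < (⨆ (K : Set ℝ) (_ : K ⊆ A) (_ : IsCompact K), volume K) +
      ⨆ (L : Set ℝ) (_ : L ⊆ B) (_ : IsCompact L), volume L := by
    rwa [← hA.measure_eq_iSup_isCompact, ← hB.measure_eq_iSup_isCompact]
  by_contra hcon
  refine absurd hr' (not_lt.2 (le_trans ?_ (not_lt.1 hcon)))
  refine ENNReal.biSup_add_biSup_le' (p := fun K : Set ℝ => K ⊆ A) (q := fun L : Set ℝ => L ⊆ B)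
    ⟨∅, Set.empty_subset _⟩ ⟨∅, Set.empty_subset _⟩ fun K hK L hL => ?_
  by_cases hKc : IsCompact K <;> by_cases hLc : IsCompact L <;> simp only [hKc, hLc, iSup_pos,
    iSup_neg, not_false_eq_true, bot_eq_zero, add_zero, zero_add, zero_le]
  · refine le_trans (add_le_add (measure_mono (Set.subset_insert a₀ K))
      (measure_mono (Set.subset_insert b₀ L))) (compact_case _ _ (hKc.insert a₀) (hLc.insert b₀)
      ⟨a₀, by simp⟩ ⟨b₀, by simp⟩ (Set.insert_subset ha₀ hK) (Set.insert_subset hb₀ hL))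
  · refine le_trans (le_trans (measure_mono (Set.subset_insert a₀ K)) le_self_add)
      (compact_case _ {b₀} (hKc.insert a₀) isCompact_singleton
      ⟨a₀, by simp⟩ ⟨b₀, by simp⟩ (Set.insert_subset ha₀ hK) (by simpa using hb₀))
  · refine le_trans (le_trans (measure_mono (Set.subset_insert b₀ L)) le_add_self)
      (compact_case {a₀} _ isCompact_singleton (hLc.insert b₀)
      ⟨a₀, by simp⟩ ⟨b₀, by simp⟩ (by simpa using ha₀) (Set.insert_subset hb₀ hL))

/-- One-dimensional Prékopa–Leindler inequality in its arithmetic form, for functions with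
values in `[0, 1]` which come arbitrarily close to `1`. -/
theorem lintegral_add_le_two_mul_lintegral_of_level_sets {f g h : ℝ → ℝ} (hf : Measurable f)
    (hg : Measurable g) (hh : Measurable h) (hf0 : ∀ x, 0 ≤ f x) (hg0 : ∀ x, 0 ≤ g x)
    (hh0 : ∀ x, 0 ≤ h x) (hf1 : ∀ x, f x ≤ 1) (hg1 : ∀ x, g x ≤ 1)
    (hfs : ∀ t < 1, ∃ x, t < f x) (hgs : ∀ t < 1, ∃ x, t < g x)
    (hfgh : ∀ t x y, 0 < t → t < f x → t < g y → t < h ((x + y) / 2)) :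
    (∫⁻ x, ENNReal.ofReal (f x)) + (∫⁻ x, ENNReal.ofReal (g x)) ≤
      2 * ∫⁻ x, ENNReal.ofReal (h x) := by
  rw [lintegral_eq_lintegral_meas_lt volume (.of_forall hf0) hf.aemeasurable,
    lintegral_eq_lintegral_meas_lt volume (.of_forall hg0) hg.aemeasurable,
    lintegral_eq_lintegral_meas_lt volume (.of_forall hh0) hh.aemeasurable,
    ← lintegral_const_mul' _ _ (by simp), ← lintegral_add_left]
  · refine setLIntegral_mono' measurableSet_Ioi fun t ht => ?_
    by_cases ht1 : t < 1
    · exact volume_add_le_two_mul_volume_midpoints (measurableSet_lt measurable_const hf)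
        (measurableSet_lt measurable_const hg) (hfs t ht1) (hgs t ht1)
        fun a ha b hb => hfgh t a b ht ha hb
    · have e1 : {a | t < f a} = ∅ := by
        ext x; simpa using (hf1 x).trans (not_lt.1 ht1)
      have e2 : {a | t < g a} = ∅ := by
        ext x; simpa using (hg1 x).trans (not_lt.1 ht1)
      simp [e1, e2]
  · refine Antitone.measurable fun s t hst => measure_mono fun x hx => lt_of_le_of_lt hst hx

theorem four_mul_le_add_sq_ennreal (x y : ℝ≥0∞) : 4 * (x * y) ≤ (x + y) ^ 2 := by
  by_cases hx : x = ⊤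
  · simp [hx]
  by_cases hy : y = ⊤
  · simp [hy]
  lift x to NNReal using hx
  lift y to NNReal using hy
  norm_cast
  rw [← NNReal.coe_le_coe]
  push_cast
  nlinarith [sq_nonneg ((x : ℝ) - y)]

/-- One-dimensional Prékopa–Leindler inequality for bounded functions. -/
theorem prekopa_leindler_real_of_bounded {f g h : ℝ → ℝ≥0∞} (hf : Measurable f)
    (hg : Measurable g) (hh : Measurable h) (hfb : ⨆ x, f x ≠ ⊤) (hgb : ⨆ x, g x ≠ ⊤)
    (hfgh : ∀ x y, f x * g y ≤ h ((x + y) / 2) ^ 2) :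
    (∫⁻ x, f x) * (∫⁻ x, g x) ≤ (∫⁻ x, h x) ^ 2 := by
  set a := ⨆ x, f x with ha
  set b := ⨆ x, g x with hb
  have hfa : ∀ x, f x ≤ a := le_iSup f
  have hgb' : ∀ x, g x ≤ b := le_iSup g
  by_cases ha0 : a = 0
  · have : ∀ x, f x = 0 := fun x => le_zero_iff.1 ((hfa x).trans ha0.le)
    simp [this]
  by_cases hb0 : b = 0
  · have : ∀ x, g x = 0 := fun x => le_zero_iff.1 ((hgb' x).trans hb0.le)
    simp [this]
  set c : ℝ≥0∞ := (a * b) ^ (1 / 2 : ℝ) with hc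
  have hab : a * b ≠ ⊤ := ENNReal.mul_ne_top hfb hgb
  have hab0 : a * b ≠ 0 := mul_ne_zero ha0 hb0
  have hc2 : c ^ 2 = a * b := by
    rw [hc, ← ENNReal.rpow_natCast, ← ENNReal.rpow_mul]; norm_num
  have hc0 : c ≠ 0 := fun h0 => hab0 (by rw [← hc2, h0]; simp)
  have hct : c ≠ ⊤ := fun h0 => hab (by rw [← hc2, h0]; simp)
  have hdiv : ∀ {u v : ℝ≥0∞}, v ≠ 0 → v ≠ ⊤ → u ≤ v → u / v ≤ 1 := fun h0 ht huv =>
    ENNReal.div_le_of_le_mul (by simpa using huv)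
  have hlt : ∀ {t : ℝ} {u v : ℝ≥0∞}, 0 ≤ t → v ≠ 0 → v ≠ ⊤ → u ≤ v →
      (t < (u / v).toReal ↔ ENNReal.ofReal t * v < u) := by
    intro t u v ht h0 hvt huv
    rw [← ENNReal.lt_div_iff_mul_lt (.inl h0) (.inl hvt), ENNReal.ofReal_lt_iff_lt_toReal ht]
    exact (ENNReal.div_lt_top (ne_top_of_le_ne_top hvt huv) h0).ne
  have key := lintegral_add_le_two_mul_lintegral_of_level_sets
    (f := fun x => (f x / a).toReal) (g := fun x => (g x / b).toReal)
    (h := fun x => (min (h x / c) 1).toReal) (by fun_prop) (by fun_prop)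
    (by fun_prop) (fun _ => ENNReal.toReal_nonneg)
    (fun _ => ENNReal.toReal_nonneg) (fun _ => ENNReal.toReal_nonneg)
    (fun x => ENNReal.toReal_le_of_le_ofReal zero_le_one (by simpa using hdiv ha0 hfb (hfa x)))
    (fun x => ENNReal.toReal_le_of_le_ofReal zero_le_one (by simpa using hdiv hb0 hgb (hgb' x)))
    ?_ ?_ ?_
  · have hfe : ∀ x, ENNReal.ofReal (f x / a).toReal = f x * a⁻¹ := fun x =>
      ENNReal.ofReal_toReal (ne_top_of_le_ne_top ENNReal.one_ne_top (hdiv ha0 hfb (hfa x)))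
    have hge : ∀ x, ENNReal.ofReal (g x / b).toReal = g x * b⁻¹ := fun x =>
      ENNReal.ofReal_toReal (ne_top_of_le_ne_top ENNReal.one_ne_top (hdiv hb0 hgb (hgb' x)))
    have hhe : ∀ x, ENNReal.ofReal (min (h x / c) 1).toReal ≤ h x * c⁻¹ := fun x =>
      ENNReal.ofReal_toReal_le.trans (min_le_left _ _)
    have key2 : (∫⁻ x, f x) * a⁻¹ + (∫⁻ x, g x) * b⁻¹ ≤ 2 * ((∫⁻ x, h x) * c⁻¹) := by
      rw [← lintegral_mul_const _ hf, ← lintegral_mul_const _ hg, ← lintegral_mul_const _ hh]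
      simp only [hfe, hge] at key
      exact key.trans (mul_le_mul_right (lintegral_mono hhe) _)
    have key3 := (four_mul_le_add_sq_ennreal _ _).trans (pow_le_pow_left' key2 2)
    have e1 : 4 * ((∫⁻ x, f x) * a⁻¹ * ((∫⁻ x, g x) * b⁻¹)) =
        4 * (((∫⁻ x, f x) * (∫⁻ x, g x)) * (c ^ 2)⁻¹) := by
      rw [hc2, ENNReal.mul_inv (.inl ha0) (.inl hfb)]; ring
    have e2 : (2 * ((∫⁻ x, h x) * c⁻¹)) ^ 2 = 4 * ((∫⁻ x, h x) ^ 2 * (c ^ 2)⁻¹) := by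
      rw [ENNReal.inv_pow]; ring
    rw [e1, e2, ENNReal.mul_le_mul_iff_right (by simp) (by simp),
      ENNReal.mul_le_mul_iff_left] at key3
    · exact key3
    · simpa using hct
    · simpa using hc0
  · intro t ht
    by_cases ht0 : t < 0
    · exact ⟨0, ht0.trans_le ENNReal.toReal_nonneg⟩
    have : ENNReal.ofReal t * a < a := by
      conv_rhs => rw [← one_mul a]
      exact ENNReal.mul_lt_mul_left ha0 hfb (by simpa using ht)
    obtain ⟨x, hx⟩ := lt_iSup_iff.1 this
    exact ⟨x, (hlt (not_lt.1 ht0) ha0 hfb (hfa x)).2 hx⟩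
  · intro t ht
    by_cases ht0 : t < 0
    · exact ⟨0, ht0.trans_le ENNReal.toReal_nonneg⟩
    have : ENNReal.ofReal t * b < b := by
      conv_rhs => rw [← one_mul b]
      exact ENNReal.mul_lt_mul_left hb0 hgb (by simpa using ht)
    obtain ⟨x, hx⟩ := lt_iSup_iff.1 this
    exact ⟨x, (hlt (not_lt.1 ht0) hb0 hgb (hgb' x)).2 hx⟩
  · intro t x y ht hx hy
    have ht1 : t < 1 := hx.trans_le
      (ENNReal.toReal_le_of_le_ofReal zero_le_one (by simpa using hdiv ha0 hfb (hfa x)))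
    rw [hlt ht.le ha0 hfb (hfa x)] at hx
    rw [hlt ht.le hb0 hgb (hgb' y)] at hy
    rw [← ENNReal.ofReal_lt_iff_lt_toReal ht.le (by simp), lt_min_iff]
    refine ⟨?_, by simpa using ht1⟩
    rw [ENNReal.lt_div_iff_mul_lt (.inl hc0) (.inl hct)]
    refine (ENNReal.pow_lt_pow_left_iff two_ne_zero).1 (lt_of_lt_of_le ?_ (hfgh x y))
    rw [mul_pow, hc2]
    calc ENNReal.ofReal t ^ 2 * (a * b) = (ENNReal.ofReal t * a) * (ENNReal.ofReal t * b) := by ring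
      _ < _ := ENNReal.mul_lt_mul hx hy

/-- One-dimensional Prékopa–Leindler inequality. -/
theorem prekopa_leindler_real {f g h : ℝ → ℝ≥0∞} (hf : Measurable f)
    (hg : Measurable g) (hh : Measurable h)
    (hfgh : ∀ x y, f x * g y ≤ h ((x + y) / 2) ^ 2) :
    (∫⁻ x, f x) * (∫⁻ x, g x) ≤ (∫⁻ x, h x) ^ 2 := by
  have hsup : ∀ k : ℝ → ℝ≥0∞, Measurable k →
      ∫⁻ x, k x = ⨆ N : ℕ, ∫⁻ x, min (k x) (N : ℝ≥0∞) := by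
    intro k hk
    rw [← lintegral_iSup (fun N => hk.min measurable_const)
      (fun N M hNM x => min_le_min le_rfl (by exact_mod_cast hNM))]
    refine lintegral_congr fun x => ?_
    rw [← inf_iSup_eq, ENNReal.iSup_natCast, inf_top_eq]
  rw [hsup f hf, hsup g hg, ENNReal.iSup_mul]
  refine iSup_le fun N => ?_
  rw [ENNReal.mul_iSup]
  refine iSup_le fun M => ?_
  refine prekopa_leindler_real_of_bounded (hf.min measurable_const) (hg.min measurable_const) hh
    (ne_top_of_le_ne_top (ENNReal.natCast_ne_top N) (iSup_le fun x => min_le_right _ _))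
    (ne_top_of_le_ne_top (ENNReal.natCast_ne_top M) (iSup_le fun x => min_le_right _ _))
    fun x y => (mul_le_mul' (min_le_left _ _) (min_le_left _ _)).trans (hfgh x y)

/-- Prékopa–Leindler inequality (for midpoints). -/
theorem prekopa_leindler_pi (n : ℕ) {f g h : (Fin n → ℝ) → ℝ≥0∞} (hf : Measurable f)
    (hg : Measurable g) (hh : Measurable h)
    (hfgh : ∀ x y, f x * g y ≤ h ((1 / 2 : ℝ) • (x + y)) ^ 2) :
    (∫⁻ x, f x) * (∫⁻ x, g x) ≤ (∫⁻ x, h x) ^ 2 := by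
  induction n with
  | zero =>
    have hv : (volume : Measure (Fin 0 → ℝ)) = Measure.dirac isEmptyElim :=
      Measure.volume_pi_eq_dirac _
    rw [hv, lintegral_dirac, lintegral_dirac, lintegral_dirac]
    convert hfgh isEmptyElim isEmptyElim
  | succ n ih =>
    set e := MeasurableEquiv.piFinSuccAbove (fun _ : Fin (n + 1) => ℝ) 0 with he
    have hint : ∀ k : (Fin (n + 1) → ℝ) → ℝ≥0∞, Measurable k →
        ∫⁻ x, k x = ∫⁻ s : ℝ, ∫⁻ x : Fin n → ℝ, k (e.symm (s, x)) := by
      intro k hk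
      rw [← (volume_preserving_piFinSuccAbove (fun _ : Fin (n + 1) => ℝ) 0).symm.lintegral_comp_emb
        (MeasurableEquiv.measurableEmbedding _)]
      exact lintegral_prod (μ := (volume : Measure ℝ)) (ν := (volume : Measure (Fin n → ℝ)))
        _ (hk.comp e.symm.measurable).aemeasurable
    have hmeas : ∀ k : (Fin (n + 1) → ℝ) → ℝ≥0∞, Measurable k →
        Measurable fun s : ℝ => ∫⁻ x : Fin n → ℝ, k (e.symm (s, x)) := fun k hk =>
      Measurable.lintegral_prod_right' (hk.comp e.symm.measurable)
    rw [hint f hf, hint g hg, hint h hh]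
    refine prekopa_leindler_real (hmeas f hf) (hmeas g hg) (hmeas h hh) fun s t => ?_
    refine ih (hf.comp (e.symm.measurable.comp measurable_prodMk_left))
      (hg.comp (e.symm.measurable.comp measurable_prodMk_left))
      (hh.comp (e.symm.measurable.comp measurable_prodMk_left)) fun x y => ?_
    have : e.symm ((s + t) / 2, (1 / 2 : ℝ) • (x + y)) =
        (1 / 2 : ℝ) • (e.symm (s, x) + e.symm (t, y)) := by
      ext i
      refine Fin.cases ?_ (fun j => ?_) i
      · simp [he, MeasurableEquiv.piFinSuccAbove]; ring
      · simp [he, MeasurableEquiv.piFinSuccAbove]; ring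
    change _ ≤ h (e.symm ((s + t) / 2, (1 / 2 : ℝ) • (x + y))) ^ 2
    rw [this]
    exact hfgh _ _

/-- Brunn–Minkowski inequality for midpoints, in its weak form. -/
theorem min_volume_le_volume_midpoints {n : ℕ} {A B C : Set (E n)} (hA : MeasurableSet A)
    (hB : MeasurableSet B) (hC : MeasurableSet C)
    (hABC : ∀ a ∈ A, ∀ b ∈ B, (1 / 2 : ℝ) • (a + b) ∈ C) :
    min (volume A) (volume B) ≤ volume C := by
  set e := (MeasurableEquiv.toLp 2 (Fin n → ℝ)) with he
  have hvol : ∀ D : Set (E n), MeasurableSet D →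
      ∫⁻ x : Fin n → ℝ, (e ⁻¹' D).indicator 1 x = volume D := by
    intro D hD
    rw [lintegral_indicator_one (e.measurable hD)]
    exact (EuclideanSpace.volume_preserving_symm_measurableEquiv_toLp (Fin n)).symm.measure_preimage
      hD.nullMeasurableSet
  have key := prekopa_leindler_pi n (f := (e ⁻¹' A).indicator 1) (g := (e ⁻¹' B).indicator 1)
    (h := (e ⁻¹' C).indicator 1) (measurable_one.indicator (e.measurable hA))
    (measurable_one.indicator (e.measurable hB)) (measurable_one.indicator (e.measurable hC)) ?_
  · rw [hvol A hA, hvol B hB, hvol C hC] at key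
    refine (ENNReal.pow_le_pow_left_iff two_ne_zero).1 (le_trans ?_ key)
    rw [sq]
    exact mul_le_mul' (min_le_left _ _) (min_le_right _ _)
  · intro x y
    by_cases hx : e x ∈ A
    · by_cases hy : e y ∈ B
      · have : e ((1 / 2 : ℝ) • (x + y)) ∈ C := hABC _ hx _ hy
        simp only [Set.indicator, Set.mem_preimage, hx, hy, this, if_true]
        simp
      · simp [Set.indicator, hy]
    · simp [Set.indicator, hx]

theorem measure_isOpen_le_liminf_mul {X : Type*} [MetricSpace X] [SecondCountableTopology X]
    [MeasurableSpace X] [BorelSpace X] {μ ν : Measure X} [IsFiniteMeasure μ] [IsFiniteMeasure ν]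
    {a b : ℝ → ℝ≥0∞} (hμ : ∀ x r, μ (ball x r) = a r) (hν : ∀ x r, ν (ball x r) = b r)
    (hb0 : ∀ r, 0 < r → b r ≠ 0) {r : ℕ → ℝ} (hr : ∀ k, 0 < r k)
    (hr0 : Filter.Tendsto r Filter.atTop (nhds 0)) {U : Set X} (hU : IsOpen U) :
    μ U ≤ Filter.liminf (fun k => a (r k) / b (r k)) Filter.atTop * ν U := by
  rcases U.eq_empty_or_nonempty with rfl | ⟨x₀, hx₀⟩
  · simp
  have hbt : ∀ s, b s ≠ ⊤ := fun s => by rw [← hν x₀ s]; exact measure_ne_top _ _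
  set S : ℕ → Set (X × X) := fun k => (U ×ˢ U) ∩ {p | dist p.1 p.2 < r k} with hS
  have hSm : ∀ k, MeasurableSet (S k) := fun k =>
    ((hU.prod hU).inter (isOpen_lt (by fun_prop) continuous_const)).measurableSet
  have hlim : ∀ x ∈ U, 1 ≤ Filter.liminf (fun k => ν (Prod.mk x ⁻¹' S k) / b (r k))
      Filter.atTop := by
    intro x hx
    obtain ⟨ε, hε, hball⟩ := Metric.isOpen_iff.1 hU x hx
    refine Filter.le_liminf_of_le (by isBoundedDefault) ?_
    filter_upwards [hr0.eventually (gt_mem_nhds hε)] with k hk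
    have : Prod.mk x ⁻¹' S k = ball x (r k) := by
      ext y
      simp only [hS, Set.mem_preimage, Set.mem_inter_iff, Set.mem_prod, Set.mem_ofPred_eq,
        mem_ball, dist_comm y x]
      exact ⟨fun h => h.2, fun h => ⟨⟨hx, hball (by
        rw [mem_ball, dist_comm]; exact h.trans hk)⟩, h⟩⟩
    rw [this, hν, ENNReal.div_self (hb0 _ (hr k)) (hbt _)]
  have hint : ∀ k, ∫⁻ x, ν (Prod.mk x ⁻¹' S k) / b (r k) ∂μ ≤ a (r k) / b (r k) * ν U := by
    intro k
    simp only [div_eq_mul_inv]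
    rw [lintegral_mul_const _ (measurable_measure_prodMk_left (hSm k)),
      ← Measure.prod_apply (hSm k), Measure.prod_apply_symm (hSm k), mul_right_comm]
    refine mul_le_mul_left ?_ _
    calc ∫⁻ y, μ ((fun x => (x, y)) ⁻¹' S k) ∂ν ≤ ∫⁻ y, U.indicator (fun _ => a (r k)) y ∂ν := by
          refine lintegral_mono fun y => ?_
          by_cases hy : y ∈ U
          · rw [Set.indicator_of_mem hy, ← hμ y]
            exact measure_mono fun x hx => hx.2
          · rw [Set.indicator_of_notMem hy]
            refine le_of_eq (measure_mono_null (t := ∅) (fun x hx => hy hx.1.2) measure_empty)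
      _ = a (r k) * ν U := by
          rw [lintegral_indicator hU.measurableSet, setLIntegral_const]
  calc μ U = ∫⁻ x, U.indicator 1 x ∂μ := (lintegral_indicator_one hU.measurableSet).symm
    _ ≤ ∫⁻ x, Filter.liminf (fun k => ν (Prod.mk x ⁻¹' S k) / b (r k)) Filter.atTop ∂μ := by
        refine lintegral_mono fun x => ?_
        by_cases hx : x ∈ U
        · rw [Set.indicator_of_mem hx]; exact hlim x hx
        · rw [Set.indicator_of_notMem hx]; exact zero_le
    _ ≤ Filter.liminf (fun k => ∫⁻ x, ν (Prod.mk x ⁻¹' S k) / b (r k) ∂μ) Filter.atTop :=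
        lintegral_liminf_le fun k => (measurable_measure_prodMk_left (hSm k)).div_const _
    _ ≤ Filter.liminf (fun k => a (r k) / b (r k) * ν U) Filter.atTop :=
        Filter.liminf_le_liminf (.of_forall hint)
    _ = Filter.liminf (fun k => a (r k) / b (r k)) Filter.atTop * ν U := by
        rw [ENNReal.liminf_mul_const_of_ne_top (measure_ne_top _ _), mul_comm]

/-- Two finite uniformly distributed measures on a compact metric space are proportional. -/
theorem exists_eq_smul_of_uniformly_distributed {X : Type*} [MetricSpace X] [CompactSpace X]
    [MeasurableSpace X] [BorelSpace X] {μ ν : Measure X} [IsFiniteMeasure μ] [IsFiniteMeasure ν]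
    [ν.IsOpenPosMeasure] {a b : ℝ → ℝ≥0∞} (hμ : ∀ x r, μ (ball x r) = a r)
    (hν : ∀ x r, ν (ball x r) = b r) : ∃ c : ℝ≥0∞, c ≠ ⊤ ∧ μ = c • ν := by
  by_cases hμ0 : μ = 0
  · exact ⟨0, by simp, by simp [hμ0]⟩
  obtain ⟨x₀⟩ : Nonempty X := by
    by_contra hX
    rw [not_nonempty_iff] at hX
    exact hμ0 (Measure.eq_zero_of_isEmpty μ)
  have ha0 : ∀ r, 0 < r → a r ≠ 0 := by
    intro r hr h0
    obtain ⟨t, -, htf, ht⟩ := finite_cover_balls_of_compact (isCompact_univ (X := X)) hr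
    refine hμ0 (Measure.measure_univ_eq_zero.1 (measure_mono_null ht ?_))
    exact (measure_biUnion_null_iff htf.countable).2 fun x _ => (hμ x r).trans h0
  have hb0 : ∀ r, 0 < r → b r ≠ 0 := fun r hr => by
    rw [← hν x₀]; exact (measure_ball_pos ν x₀ hr).ne'
  have hat : ∀ s, a s ≠ ⊤ := fun s => by rw [← hμ x₀ s]; exact measure_ne_top _ _
  have hbt : ∀ s, b s ≠ ⊤ := fun s => by rw [← hν x₀ s]; exact measure_ne_top _ _
  set r : ℕ → ℝ := fun k => 1 / ((k : ℝ) + 1)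
  have hr : ∀ k, 0 < r k := fun k => Nat.one_div_pos_of_nat
  have hr0 : Filter.Tendsto r Filter.atTop (nhds 0) := tendsto_one_div_add_atTop_nhds_zero_nat
  set c := Filter.liminf (fun k => a (r k) / b (r k)) Filter.atTop with hc
  have h1 : ∀ U : Set X, IsOpen U → μ U ≤ c * ν U := fun U hU =>
    measure_isOpen_le_liminf_mul hμ hν hb0 hr hr0 hU
  have h2 : ∀ U : Set X, IsOpen U → ν U ≤ c⁻¹ * μ U := fun U hU => by
    refine (measure_isOpen_le_liminf_mul hν hμ ha0 hr hr0 hU).trans (mul_le_mul_left ?_ _)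
    rw [hc, ENNReal.inv_liminf]
    refine (Filter.liminf_le_limsup).trans (le_of_eq (congrArg (fun f =>
      Filter.limsup f Filter.atTop) (funext fun k => ?_)))
    rw [ENNReal.inv_div (.inl (hbt _)) (.inl (hb0 _ (hr k)))]
  have hc0 : c ≠ 0 := fun h0 => hμ0 (Measure.measure_univ_eq_zero.1 (le_zero_iff.1 (by
    simpa [h0] using h1 _ isOpen_univ)))
  have hct : c ≠ ⊤ := fun h0 => by
    have := h2 _ isOpen_univ
    simp only [h0, ENNReal.inv_top, zero_mul, nonpos_iff_eq_zero] at this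
    exact (isOpen_univ.measure_pos ν ⟨x₀, trivial⟩).ne' this
  refine ⟨c, hct, ?_⟩
  have : IsFiniteMeasure (c • ν) := by
    refine ⟨?_⟩
    simpa using ENNReal.mul_lt_top hct.lt_top (measure_lt_top ν _)
  refine Measure.OuterRegular.ext_isOpen fun U hU => le_antisymm (h1 U hU) ?_
  calc c * ν U ≤ c * (c⁻¹ * μ U) := mul_le_mul_right (h2 U hU) _
    _ = μ U := by rw [← mul_assoc, ENNReal.mul_inv_cancel hc0 hct, one_mul]

/-- The restriction of a linear isometry to the unit sphere. -/
def sphereIsometryEquiv {n : ℕ} (e : E n ≃ₗᵢ[ℝ] E n) :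
    sphere (0 : E n) 1 ≃ᵢ sphere (0 : E n) 1 where
  toFun x := ⟨e x, by simp⟩
  invFun x := ⟨e.symm x, by simp⟩
  left_inv x := by simp
  right_inv x := by simp
  isometry_toFun := Isometry.of_dist_eq fun x y => by
    simp [Subtype.dist_eq, e.dist_map]

theorem exists_sphereIsometryEquiv_apply_eq {n : ℕ} (x y : sphere (0 : E n) 1) :
    ∃ e : E n ≃ₗᵢ[ℝ] E n, sphereIsometryEquiv e x = y :=
  ⟨(ℝ ∙ ((x : E n) - y))ᗮ.reflection, Subtype.ext (Submodule.reflection_sub (by simp))⟩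

open Pointwise in
theorem toSphere_ball_eq {n : ℕ} (x y : sphere (0 : E n) 1) (r : ℝ) :
    (volume : Measure (E n)).toSphere (ball x r) =
      (volume : Measure (E n)).toSphere (ball y r) := by
  obtain ⟨e, rfl⟩ := exists_sphereIsometryEquiv_apply_eq x y
  rw [Measure.toSphere_apply' _ measurableSet_ball, Measure.toSphere_apply' _ measurableSet_ball,
    ← (sphereIsometryEquiv e).image_ball]
  have : Set.Ioo (0 : ℝ) 1 • (Subtype.val '' (sphereIsometryEquiv e '' ball x r)) =
      e '' (Set.Ioo (0 : ℝ) 1 • (Subtype.val '' ball x r)) := by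
    ext z
    simp only [Set.mem_smul, Set.mem_image]
    constructor
    · rintro ⟨t, ht, _, ⟨_, ⟨w, hw, rfl⟩, rfl⟩, rfl⟩
      exact ⟨t • (w : E n), ⟨t, ht, w, ⟨w, hw, rfl⟩, rfl⟩, by simp [sphereIsometryEquiv]⟩
    · rintro ⟨_, ⟨t, ht, _, ⟨w, hw, rfl⟩, rfl⟩, rfl⟩
      exact ⟨t, ht, e w, ⟨_, ⟨w, hw, rfl⟩, rfl⟩, by simp⟩
  rw [this]
  congr 1
  have hp := e.symm.measurePreserving.measure_preimage_equiv (f := e.symm.toMeasurableEquiv)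
    (Set.Ioo (0 : ℝ) 1 • (Subtype.val '' ball x r))
  rw [← hp]
  congr 1
  exact (e.toEquiv.image_eq_preimage_symm _).symm

theorem hausdorffMeasure_sphere_lt_top (m : ℕ) :
    μH[(m : ℝ)] (sphere (0 : E (m + 1)) 1) < ⊤ := by
  set cube : Set (Fin m → ℝ) := Set.Icc (fun _ => -1) (fun _ => 1) with hcube
  set face : Fin (m + 1) → ℝ → (Fin m → ℝ) → E (m + 1) :=
    fun i σ y => WithLp.toLp 2 (i.insertNth σ y : Fin (m + 1) → ℝ) with hface
  have hface_smooth : ∀ i σ, ContDiff ℝ 1 (face i σ) := by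
    intro i σ
    refine contDiff_euclidean.2 fun j => ?_
    refine Fin.succAboveCases i ?_ (fun k => ?_) j
    · simpa [hface] using contDiff_const
    · simpa [hface] using contDiff_apply ℝ ℝ k
  have hface_ne : ∀ i (σ : ℝ), σ ≠ 0 → ∀ y, face i σ y ≠ 0 := by
    intro i σ hσ y h0
    have := congrArg (fun z : E (m + 1) => z i) h0
    simp [hface] at this
    exact hσ this
  have himage : ∀ i (σ : ℝ), σ ≠ 0 →
      μH[(m : ℝ)] ((fun y => ‖face i σ y‖⁻¹ • face i σ y) '' cube) < ⊤ := by
    intro i σ hσ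
    have hsm : ContDiffOn ℝ 1 (fun y => ‖face i σ y‖⁻¹ • face i σ y) cube := by
      refine ContDiff.contDiffOn (ContDiff.smul (ContDiff.inv ((hface_smooth i σ).norm ℝ
        (hface_ne i σ hσ)) fun y => norm_ne_zero_iff.2 (hface_ne i σ hσ y)) (hface_smooth i σ))
    obtain ⟨K, hK⟩ := hsm.exists_lipschitzOnWith one_ne_zero (convex_Icc _ _) isCompact_Icc
    refine (hK.hausdorffMeasure_image_le (Nat.cast_nonneg m)).trans_lt ?_
    refine ENNReal.mul_lt_top (ENNReal.rpow_lt_top_of_nonneg (Nat.cast_nonneg m) (by simp)) ?_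
    have hv : (μH[(m : ℝ)] : Measure (Fin m → ℝ)) = volume := by
      simpa using hausdorffMeasure_pi_real (ι := Fin m)
    rw [hv]
    exact isCompact_Icc.measure_lt_top
  have hcover : sphere (0 : E (m + 1)) 1 ⊆ ⋃ i : Fin (m + 1), ⋃ s : Bool,
      (fun y => ‖face i (if s then 1 else -1) y‖⁻¹ • face i (if s then 1 else -1) y) '' cube := by
    intro x hx
    obtain ⟨i, -, hi⟩ := Finset.exists_max_image Finset.univ (fun j => |x j|) ⟨0, by simp⟩
    have hxi : 0 < |x i| := by
      rw [abs_pos]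
      intro h0
      have : x = 0 := by
        ext j
        have := hi j (by simp)
        rw [h0, abs_zero] at this
        simpa using abs_nonpos_iff.1 this
      simp [this] at hx
    have hcomb : face i (x i / |x i|) (fun j => x (i.succAbove j) / |x i|) = |x i|⁻¹ • x := by
      ext j
      refine Fin.succAboveCases i ?_ (fun k => ?_) j
      · simp [hface, div_eq_inv_mul]
      · simp [hface, div_eq_inv_mul]
    have hsign : ∃ s : Bool, x i / |x i| = if s then 1 else -1 := by
      rcases lt_or_ge (x i) 0 with h | h
      · refine ⟨false, ?_⟩
        rw [abs_of_neg h, div_neg, div_self h.ne]; simp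
      · refine ⟨true, ?_⟩
        rw [abs_of_nonneg h] at hxi ⊢
        rw [div_self hxi.ne']; simp
    obtain ⟨s, hs⟩ := hsign
    simp only [Set.mem_iUnion]
    refine ⟨i, s, fun j => x (i.succAbove j) / |x i|, ?_, ?_⟩
    · rw [hcube, Set.mem_Icc]
      have : ∀ j, abs (x (i.succAbove j) / |x i|) ≤ 1 := fun j => by
        rw [abs_div, abs_abs]
        exact div_le_one_of_le₀ (hi _ (by simp)) (abs_nonneg _)
      exact ⟨fun j => (abs_le.1 (this j)).1, fun j => (abs_le.1 (this j)).2⟩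
    · simp only
      rw [← hs, hcomb, norm_smul, norm_inv, Real.norm_eq_abs, abs_abs,
        mem_sphere_zero_iff_norm.1 hx,
        mul_one, inv_inv, smul_smul, mul_inv_cancel₀ hxi.ne', one_smul]
  refine (measure_mono hcover).trans_lt ?_
  refine (measure_iUnion_le _).trans_lt ?_
  rw [tsum_fintype]
  refine ENNReal.sum_lt_top.2 fun i _ => (measure_iUnion_le _).trans_lt ?_
  rw [tsum_fintype]
  refine ENNReal.sum_lt_top.2 fun s _ => himage i _ ?_
  cases s <;> simp

/-- The Hausdorff measure on the unit sphere is proportional to the cone measure. -/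
theorem exists_setIntegral_sphere_hausdorffMeasure_eq {n : ℕ} (hn : 1 ≤ n) :
    ∃ c : ℝ, 0 ≤ c ∧ ∀ f : E n → ℝ, ∫ u in sphere (0 : E n) 1, f u ∂μH[(n : ℝ) - 1] =
      c * ∫ u : sphere (0 : E n) 1, f u ∂(volume : Measure (E n)).toSphere := by
  obtain ⟨m, rfl⟩ : ∃ m, n = m + 1 := ⟨n - 1, by omega⟩
  have hd : ((m + 1 : ℕ) : ℝ) - 1 = m := by push_cast; ring
  rw [hd]
  have hmap := (isometry_subtype_coe (s := sphere (0 : E (m + 1)) 1)).map_hausdorffMeasure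
    (d := (m : ℝ)) (.inl (Nat.cast_nonneg m))
  rw [Subtype.range_coe] at hmap
  have : IsFiniteMeasure (μH[(m : ℝ)] : Measure (sphere (0 : E (m + 1)) 1)) := by
    refine ⟨?_⟩
    rw [← (isometry_subtype_coe (s := sphere (0 : E (m + 1)) 1)).hausdorffMeasure_image
      (.inl (Nat.cast_nonneg m)), Set.image_univ, Subtype.range_coe]
    exact hausdorffMeasure_sphere_lt_top m
  obtain ⟨x₀, hx₀⟩ : (sphere (0 : E (m + 1)) 1).Nonempty :=
    NormedSpace.sphere_nonempty.2 zero_le_one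
  obtain ⟨c, hct, hc⟩ := exists_eq_smul_of_uniformly_distributed
    (μ := (μH[(m : ℝ)] : Measure (sphere (0 : E (m + 1)) 1)))
    (ν := (volume : Measure (E (m + 1))).toSphere)
    (a := fun r => μH[(m : ℝ)] (ball (⟨x₀, hx₀⟩ : sphere (0 : E (m + 1)) 1) r))
    (b := fun r => (volume : Measure (E (m + 1))).toSphere
      (ball (⟨x₀, hx₀⟩ : sphere (0 : E (m + 1)) 1) r))
    (fun x r => by
      obtain ⟨e, rfl⟩ := exists_sphereIsometryEquiv_apply_eq ⟨x₀, hx₀⟩ x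
      rw [← (sphereIsometryEquiv e).image_ball, IsometryEquiv.hausdorffMeasure_image])
    (fun x r => toSphere_ball_eq _ _ _)
  refine ⟨c.toReal, ENNReal.toReal_nonneg, fun f => ?_⟩
  rw [← hmap, (MeasurableEmbedding.subtype_coe isClosed_sphere.measurableSet).integral_map, hc,
    integral_smul_measure, smul_eq_mul]

theorem le_of_second_deriv_ge {f f' f'' : ℝ → ℝ} {m : ℝ}
    (hf : ∀ t ∈ Set.Icc (0 : ℝ) 1, HasDerivAt f (f' t) t)
    (hf' : ∀ t ∈ Set.Icc (0 : ℝ) 1, HasDerivAt f' (f'' t) t)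
    (hm : ∀ t ∈ Set.Icc (0 : ℝ) 1, m ≤ f'' t) : f 0 + f' 0 + m / 2 ≤ f 1 := by
  have h1 : MonotoneOn (fun t => f' t - m * t) (Set.Icc 0 1) := by
    have hd : ∀ t ∈ Set.Icc (0 : ℝ) 1, HasDerivAt (fun t => f' t - m * t) (f'' t - m * 1) t :=
      fun t ht => (hf' t ht).sub ((hasDerivAt_id t).const_mul m)
    refine monotoneOn_of_hasDerivWithinAt_nonneg (f' := fun t => f'' t - m * 1) (convex_Icc _ _)
      (fun t ht => (hd t ht).continuousAt.continuousWithinAt)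
      (fun t ht => (hd t (interior_subset ht)).hasDerivWithinAt)
      (fun t ht => ?_)
    have := hm t (interior_subset ht)
    linarith
  have h2 : MonotoneOn (fun t => f t - f' 0 * t - m / 2 * t ^ 2) (Set.Icc 0 1) := by
    have hd : ∀ t ∈ Set.Icc (0 : ℝ) 1, HasDerivAt (fun t => f t - f' 0 * t - m / 2 * t ^ 2)
        (f' t - f' 0 * 1 - m / 2 * (2 * t)) t :=
      fun t ht => ((hf t ht).sub ((hasDerivAt_id t).const_mul _)).sub
        (by simpa using (hasDerivAt_pow 2 t).const_mul (m / 2))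
    refine monotoneOn_of_hasDerivWithinAt_nonneg
      (f' := fun t => f' t - f' 0 * 1 - m / 2 * (2 * t)) (convex_Icc _ _)
      (fun t ht => (hd t ht).continuousAt.continuousWithinAt)
      (fun t ht => (hd t (interior_subset ht)).hasDerivWithinAt)
      (fun t ht => ?_)
    have := h1 (Set.left_mem_Icc.2 zero_le_one) (interior_subset ht) (interior_subset ht).1
    simp only at this ⊢
    linarith
  have := h2 (Set.left_mem_Icc.2 zero_le_one) (Set.right_mem_Icc.2 zero_le_one) zero_le_one
  simp only at this
  linarith

section Homogeneous

variable {n : ℕ} {k : E n → ℝ}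

theorem contDiffAt_of_ne_zero (hk2 : ContDiffOn ℝ 2 k {(0 : E n)}ᶜ) {x : E n} (hx : x ≠ 0) :
    ContDiffAt ℝ 2 k x :=
  hk2.contDiffAt (isOpen_compl_singleton.mem_nhds hx)

theorem inner_gradient_eq_fderiv (x v : E n) : ⟪gradient k x, v⟫ = fderiv ℝ k x v := by
  simp [gradient]

theorem hasGradientAt_of_ne_zero (hk2 : ContDiffOn ℝ 2 k {(0 : E n)}ᶜ) {x : E n} (hx : x ≠ 0) :
    HasGradientAt k (gradient k x) x :=
  ((contDiffAt_of_ne_zero hk2 hx).differentiableAt (by norm_num)).hasGradientAt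

theorem contDiffAt_gradient (hk2 : ContDiffOn ℝ 2 k {(0 : E n)}ᶜ) {x : E n} (hx : x ≠ 0) :
    ContDiffAt ℝ 1 (gradient k) x :=
  (InnerProductSpace.toDual ℝ (E n)).symm.contDiff.contDiffAt.comp x
    ((contDiffAt_of_ne_zero hk2 hx).fderiv_right (by norm_num))

theorem hasFDerivAt_gradient (hk2 : ContDiffOn ℝ 2 k {(0 : E n)}ᶜ) {x : E n} (hx : x ≠ 0) :
    HasFDerivAt (gradient k) (sHess k x) x :=
  ((contDiffAt_gradient hk2 hx).differentiableAt (by norm_num)).hasFDerivAt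

theorem continuousOn_sHess (hk2 : ContDiffOn ℝ 2 k {(0 : E n)}ᶜ) :
    ContinuousOn (sHess k) {(0 : E n)}ᶜ :=
  fun _ hx => ((contDiffAt_gradient hk2 hx).fderiv_right (m := 0)
    (by norm_num)).continuousAt.continuousWithinAt

theorem inner_sHess_eq (hk2 : ContDiffOn ℝ 2 k {(0 : E n)}ᶜ) {x : E n} (hx : x ≠ 0) (v w : E n) :
    ⟪sHess k x v, w⟫ = fderiv ℝ (fderiv ℝ k) x v w := by
  have h1 : HasFDerivAt (fun y => fderiv ℝ k y) (fderiv ℝ (fderiv ℝ k) x) x :=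
    (((contDiffAt_of_ne_zero hk2 hx).fderiv_right (m := 1) (by norm_num)).differentiableAt
      (by norm_num)).hasFDerivAt
  have h2 := (InnerProductSpace.toDual ℝ (E n)).symm.toContinuousLinearEquiv.hasFDerivAt.comp x h1
  have h3 := (hasFDerivAt_gradient hk2 hx).unique h2
  rw [h3]
  simp

theorem inner_sHess_symm (hk2 : ContDiffOn ℝ 2 k {(0 : E n)}ᶜ) {x : E n} (hx : x ≠ 0)
    (v w : E n) : ⟪sHess k x v, w⟫ = ⟪v, sHess k x w⟫ := by
  rw [real_inner_comm (sHess k x w) v, inner_sHess_eq hk2 hx, inner_sHess_eq hk2 hx]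
  exact ((contDiffAt_of_ne_zero hk2 hx).isSymmSndFDerivAt (by simp)).eq v w

theorem gradient_smul (hk1 : homog1 k) (hk2 : ContDiffOn ℝ 2 k {(0 : E n)}ᶜ) {t : ℝ} (ht : 0 < t)
    {x : E n} (hx : x ≠ 0) : gradient k (t • x) = gradient k x := by
  have htx : t • x ≠ 0 := smul_ne_zero ht.ne' hx
  have h1 : HasFDerivAt k (InnerProductSpace.toDual ℝ (E n) (gradient k (t • x))) (t • x) :=
    (hasGradientAt_of_ne_zero hk2 htx).hasFDerivAt
  have h2 := (h1.comp x ((hasFDerivAt_id x).const_smul t))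
  have h3 := ((hasGradientAt_of_ne_zero hk2 hx).hasFDerivAt).const_smul t
  have h4 : (fun y => k (t • y)) = t • k := by
    ext y; simp [hk1 t ht y]
  change HasFDerivAt (fun y => k (t • y)) _ x at h2
  rw [h4] at h2
  have h5 := h2.unique h3
  refine ext_inner_right ℝ fun v => ?_
  have h6 := congrArg (fun L => L v) h5
  simp only [ContinuousLinearMap.comp_apply, smul_apply,
    InnerProductSpace.toDual_apply_apply, ContinuousLinearMap.id_apply, inner_smul_right,
    smul_eq_mul] at h6
  exact mul_left_cancel₀ ht.ne' h6

theorem inner_gradient_self (hk1 : homog1 k) (hk2 : ContDiffOn ℝ 2 k {(0 : E n)}ᶜ) {x : E n}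
    (hx : x ≠ 0) : ⟪gradient k x, x⟫ = k x := by
  have h1 := (hasGradientAt_of_ne_zero hk2 hx).hasFDerivAt
  have h2 : HasDerivAt (fun t : ℝ => t • x) ((1 : ℝ) • x) 1 := (hasDerivAt_id 1).smul_const x
  rw [← one_smul ℝ x] at h1
  have h3 := h1.comp_hasDerivAt (1 : ℝ) h2
  have h4 : HasDerivAt (fun t : ℝ => t * k x) (1 * k x) 1 := (hasDerivAt_id 1).mul_const _
  have h5 : (k ∘ fun t : ℝ => t • x) =ᶠ[nhds 1] fun t : ℝ => t * k x := by
    filter_upwards [lt_mem_nhds zero_lt_one] with t ht using hk1 t ht x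
  have h6 := h3.unique (h4.congr_of_eventuallyEq h5)
  simpa using h6

theorem sHess_smul (hk1 : homog1 k) (hk2 : ContDiffOn ℝ 2 k {(0 : E n)}ᶜ) {t : ℝ} (ht : 0 < t)
    {x : E n} (hx : x ≠ 0) : sHess k (t • x) = t⁻¹ • sHess k x := by
  have htx : t • x ≠ 0 := smul_ne_zero ht.ne' hx
  have h2 := ((hasFDerivAt_gradient hk2 htx).comp x ((hasFDerivAt_id x).const_smul t))
  have h4 : (fun y => gradient k (t • y)) =ᶠ[nhds x] gradient k := by
    filter_upwards [isOpen_compl_singleton.mem_nhds hx] with y hy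
    exact gradient_smul hk1 hk2 ht hy
  have h5 := h2.unique ((hasFDerivAt_gradient hk2 hx).congr_of_eventuallyEq h4)
  rw [← h5]
  ext1 v
  simp [smul_smul, inv_mul_cancel₀ ht.ne']

theorem sHess_apply_self (hk1 : homog1 k) (hk2 : ContDiffOn ℝ 2 k {(0 : E n)}ᶜ) {x : E n}
    (hx : x ≠ 0) : sHess k x x = 0 := by
  have h1 := hasFDerivAt_gradient hk2 hx
  have h2 : HasDerivAt (fun t : ℝ => t • x) ((1 : ℝ) • x) 1 := (hasDerivAt_id 1).smul_const x
  rw [← one_smul ℝ x] at h1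
  have h3 := h1.comp_hasDerivAt (1 : ℝ) h2
  have h5 : (gradient k ∘ fun t : ℝ => t • x) =ᶠ[nhds 1] fun _ => gradient k x := by
    filter_upwards [lt_mem_nhds zero_lt_one] with t ht using gradient_smul hk1 hk2 ht hx
  have h6 := h3.unique ((hasDerivAt_const (1 : ℝ) (gradient k x)).congr_of_eventuallyEq h5)
  simpa using h6

theorem segment_ge_of_sHess_ge (hk2 : ContDiffOn ℝ 2 k {(0 : E n)}ᶜ) {x y : E n} {m : ℝ}
    (h0 : ∀ t ∈ Set.Icc (0 : ℝ) 1, x + t • (y - x) ≠ 0)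
    (hm : ∀ t ∈ Set.Icc (0 : ℝ) 1, m ≤ ⟪sHess k (x + t • (y - x)) (y - x), y - x⟫) :
    k x + ⟪gradient k x, y - x⟫ + m / 2 ≤ k y := by
  have hγ : ∀ t : ℝ, HasDerivAt (fun t : ℝ => x + t • (y - x)) (y - x) t := fun t => by
    simpa using ((hasDerivAt_id t).smul_const (y - x)).const_add x
  have := le_of_second_deriv_ge (f := fun t => k (x + t • (y - x)))
    (f' := fun t => ⟪gradient k (x + t • (y - x)), y - x⟫)
    (f'' := fun t => ⟪sHess k (x + t • (y - x)) (y - x), y - x⟫) (m := m)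
    (fun t ht => by
      exact ((hasGradientAt_of_ne_zero hk2 (h0 t ht)).hasFDerivAt.comp_hasDerivAt t
        (hγ t)).congr_deriv (InnerProductSpace.toDual_apply_apply ..))
    (fun t ht => by
      have h1 := (hasFDerivAt_gradient hk2 (h0 t ht)).comp_hasDerivAt t (hγ t)
      simpa using h1.inner ℝ (hasDerivAt_const t (y - x))) hm
  simpa using this

/-- A `C²` positively homogeneous function with nonnegative Hessian is the support function of
the convex hull of its gradients. -/
theorem inner_gradient_le (hn : 2 ≤ n) (hk1 : homog1 k) (hk2 : ContDiffOn ℝ 2 k {(0 : E n)}ᶜ)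
    (hpos : ∀ x : E n, x ≠ 0 → ∀ v, 0 ≤ ⟪sHess k x v, v⟫) {x y : E n} (hx : x ≠ 0) (hy : y ≠ 0) :
    ⟪gradient k x, y⟫ ≤ k y := by
  have key : ∀ z : E n, (∀ t ∈ Set.Icc (0 : ℝ) 1, x + t • (z - x) ≠ 0) →
      ⟪gradient k x, z⟫ ≤ k z := by
    intro z hz
    have := segment_ge_of_sHess_ge hk2 (m := 0) hz fun t ht => hpos _ (hz t ht) _
    rw [inner_sub_right, inner_gradient_self hk1 hk2 hx] at this
    linarith
  obtain ⟨v, hv⟩ : ∃ v : E n, v ∉ Submodule.span ℝ {x} := by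
    by_contra! hall
    have htop : Submodule.span ℝ {x} = ⊤ := Submodule.eq_top_iff'.2 hall
    have := finrank_span_singleton (K := ℝ) hx
    rw [htop, finrank_top, finrank_euclideanSpace_fin] at this
    omega
  by_cases hyx : y ∈ Submodule.span ℝ {x}
  · have hlim : Filter.Tendsto (fun s : ℝ => y + s • v) (nhdsWithin 0 {0}ᶜ) (nhds y) := by
      have : Continuous fun s : ℝ => y + s • v := by fun_prop
      have h := this.tendsto 0
      simp only [zero_smul, add_zero] at h
      exact h.mono_left nhdsWithin_le_nhds
    refine le_of_tendsto_of_tendsto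
      ((continuous_const.inner continuous_id).continuousAt.tendsto.comp hlim)
      ((contDiffAt_of_ne_zero hk2 hy).continuousAt.tendsto.comp hlim) ?_
    filter_upwards [self_mem_nhdsWithin] with s hs
    refine key (y + s • v) fun t ht h0 => ?_
    rcases eq_or_ne t 0 with rfl | ht0
    · simp [hx] at h0
    · refine hv ?_
      have h1 : v = (t * s)⁻¹ • (t • (x - y) - x) := by
        rw [eq_inv_smul_iff₀ (mul_ne_zero ht0 hs), eq_sub_iff_add_eq, ← sub_eq_zero]
        calc (t * s) • v + x - t • (x - y) = x + t • (y + s • v - x) := by module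
          _ = 0 := h0
      rw [h1]
      have hxm := Submodule.mem_span_singleton_self (R := ℝ) x
      exact Submodule.smul_mem _ _ (Submodule.sub_mem _ (Submodule.smul_mem _ _
        (Submodule.sub_mem _ hxm hyx)) hxm)
  · refine key y fun t ht h0 => hyx ?_
    rcases eq_or_ne t 0 with rfl | ht0
    · simp [hx] at h0
    · have h1 : y = t⁻¹ • (t • x - x) := by
        rw [eq_inv_smul_iff₀ ht0, eq_sub_iff_add_eq, ← sub_eq_zero, ← h0]
        module
      rw [h1]
      have hxm := Submodule.mem_span_singleton_self (R := ℝ) x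
      exact Submodule.smul_mem _ _ (Submodule.sub_mem _ (Submodule.smul_mem _ _ hxm) hxm)

end Homogeneous

section Determinant

variable {n : ℕ}

theorem contDiff_continuousLinearMap_det : ContDiff ℝ 1 (fun A : E n →L[ℝ] E n => A.det) := by
  have h : (fun A : E n →L[ℝ] E n => A.det) = fun A : E n →L[ℝ] E n =>
      ∑ σ : Equiv.Perm (Fin n), ((Equiv.Perm.sign σ : ℤ) : ℝ) *
        ∏ i, A (EuclideanSpace.basisFun (Fin n) ℝ i) (σ i) := by
    ext A
    rw [ContinuousLinearMap.det,
      ← LinearMap.det_toMatrix (EuclideanSpace.basisFun (Fin n) ℝ).toBasis, Matrix.det_apply']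
    simp [LinearMap.toMatrix_apply]
  rw [h]
  refine ContDiff.sum fun σ _ => contDiff_const.mul (contDiff_prod fun i _ => ?_)
  have h1 : ContDiff ℝ 1 fun A : E n →L[ℝ] E n => A (EuclideanSpace.basisFun (Fin n) ℝ i) :=
    contDiff_id.clm_apply contDiff_const
  exact contDiff_euclidean.1 h1 (σ i)

theorem hasFDerivAt_det_one_add : HasFDerivAt (fun A : E n →L[ℝ] E n => (1 + A).det)
    (LinearMap.toContinuousLinearMap ((LinearMap.trace ℝ (E n)).comp
      (ContinuousLinearMap.coeLM ℝ))) 0 := by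
  have h1 : DifferentiableAt ℝ (fun A : E n →L[ℝ] E n => (1 + A).det) 0 :=
    ((contDiff_continuousLinearMap_det.differentiable (by norm_num)).comp
      (differentiable_const (1 : E n →L[ℝ] E n) |>.add differentiable_id)) 0
  convert h1.hasFDerivAt using 1
  ext A
  have h2 : HasDerivAt (fun s : ℝ => (1 + s • A).det) (fderiv ℝ (fun A : E n →L[ℝ] E n =>
      (1 + A).det) 0 A) 0 := by
    have h3 : HasDerivAt (fun s : ℝ => s • A) ((1 : ℝ) • A) 0 := (hasDerivAt_id 0).smul_const A
    have h4 := h1.hasFDerivAt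
    rw [← zero_smul ℝ A] at h4
    exact (h4.comp_hasDerivAt (0 : ℝ) h3).congr_deriv (by rw [zero_smul, one_smul])
  set b := (EuclideanSpace.basisFun (Fin n) ℝ).toBasis
  set N := LinearMap.toMatrix b b (A : E n →ₗ[ℝ] E n) with hN
  have h5 : (fun s : ℝ => (1 + s • A).det) = fun s => 1 + N.trace * s +
      (1 + (Polynomial.X : Polynomial ℝ) • N.map Polynomial.C).det.divX.divX.eval s * s ^ 2 := by
    ext s
    rw [← Matrix.det_one_add_smul, ContinuousLinearMap.det, ← LinearMap.det_toMatrix b]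
    congr 1
    rw [hN, ContinuousLinearMap.toLinearMap_add, ContinuousLinearMap.toLinearMap_smul, map_add,
      map_smul]
    congr 1
    exact LinearMap.toMatrix_one b
  rw [h5] at h2
  set P := (1 + (Polynomial.X : Polynomial ℝ) • N.map Polynomial.C).det.divX.divX
  have h6 : HasDerivAt (fun s : ℝ => 1 + N.trace * s + P.eval s * s ^ 2) N.trace 0 := by
    exact ((((hasDerivAt_id (0 : ℝ)).const_mul N.trace).const_add 1).add
      ((P.hasDerivAt 0).mul (hasDerivAt_pow 2 (0 : ℝ)))).congr_deriv (by simp)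
  rw [← h2.unique h6 |>.symm, hN]
  exact (LinearMap.trace_eq_matrix_trace ℝ b _)

theorem exists_abs_det_one_add_sub_le {κ : ℝ} (hκ : 0 < κ) : ∃ ρ > 0, ∀ A : E n →L[ℝ] E n,
    ‖A‖ < ρ → |(1 + A).det - 1 - LinearMap.trace ℝ (E n) (A : E n →ₗ[ℝ] E n)| ≤ κ * ‖A‖ := by
  have h := (hasFDerivAt_iff_isLittleO_nhds_zero.1 (hasFDerivAt_det_one_add (n := n))).def hκ
  obtain ⟨ρ, hρ, hb⟩ := Metric.eventually_nhds_iff.1 h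
  refine ⟨ρ, hρ, fun A hA => ?_⟩
  have := hb (y := A) (by simpa using hA)
  simpa [ContinuousLinearMap.det, Real.norm_eq_abs] using this

theorem det_pos_of_inner_pos {A : E n →L[ℝ] E n} (hs : ∀ v w, ⟪A v, w⟫ = ⟪v, A w⟫)
    (hp : ∀ v, v ≠ 0 → 0 < ⟪A v, v⟫) : 0 < A.det := by
  have hsym : (A : E n →ₗ[ℝ] E n).IsSymmetric := fun v w => hs v w
  rw [ContinuousLinearMap.det, hsym.det_eq_prod_eigenvalues finrank_euclideanSpace_fin]
  refine Finset.prod_pos fun i _ => ?_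
  have hv := hsym.hasEigenvector_eigenvectorBasis finrank_euclideanSpace_fin i
  have h1 := hp _ hv.2
  rw [← ContinuousLinearMap.coe_coe, hv.apply_eq_smul, real_inner_smul_left] at h1
  exact pos_of_mul_pos_left h1 real_inner_self_nonneg

end Determinant

section Sphere

variable {n : ℕ} {h : E n → ℝ}

theorem tproj_apply (u v : E n) : tproj u v = v - ⟪u, v⟫ • u := by
  simp [tproj]

theorem inner_tproj_of_unit {u : E n} (hu : ‖u‖ = 1) (v : E n) : ⟪u, tproj u v⟫ = 0 := by
  rw [tproj_apply, inner_sub_right, real_inner_smul_right, real_inner_self_eq_norm_sq, hu]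
  ring

theorem tproj_eq_self {u v : E n} (huv : ⟪u, v⟫ = 0) : tproj u v = v := by
  rw [tproj_apply, huv, zero_smul, sub_zero]

theorem continuous_tproj : Continuous (tproj : E n → E n →L[ℝ] E n) := by
  unfold tproj
  refine continuous_const.sub ?_
  exact ((ContinuousLinearMap.smulRightL ℝ (E n) (E n)).continuous.comp
    (innerSL ℝ).continuous).clm_apply continuous_id

/-- The endomorphism whose determinant defines `sdet h u`. -/
def sMat (h : E n → ℝ) (u : E n) : E n →L[ℝ] E n :=
  (tproj u).comp ((sHess h u).comp (tproj u)) + (innerSL ℝ u).smulRight u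

theorem sdet_eq (u : E n) : sdet h u = (sMat h u).det := rfl

variable (hk1 : homog1 h) (hk2 : ContDiffOn ℝ 2 h {(0 : E n)}ᶜ)

include hk1 hk2

theorem sMat_apply {u : E n} (hu : ‖u‖ = 1) (v : E n) :
    sMat h u v = sHess h u v + ⟪u, v⟫ • u := by
  have hu0 : u ≠ 0 := by rintro rfl; simp at hu
  have h1 : sHess h u (tproj u v) = sHess h u v := by
    rw [tproj_apply, map_sub, map_smul, sHess_apply_self hk1 hk2 hu0, smul_zero, sub_zero]
  have h2 : ⟪u, sHess h u v⟫ = 0 := by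
    rw [← inner_sHess_symm hk2 hu0, sHess_apply_self hk1 hk2 hu0, inner_zero_left]
  simp [sMat, h1, tproj_eq_self h2]

theorem sMat_symm {u : E n} (hu : ‖u‖ = 1) (v w : E n) : ⟪sMat h u v, w⟫ = ⟪v, sMat h u w⟫ := by
  have hu0 : u ≠ 0 := by rintro rfl; simp at hu
  rw [sMat_apply hk1 hk2 hu, sMat_apply hk1 hk2 hu, inner_add_left, inner_add_right,
    inner_sHess_symm hk2 hu0, real_inner_smul_left, real_inner_smul_right, real_inner_comm v u]
  ring

theorem inner_sHess_tproj {u : E n} (hu : ‖u‖ = 1) (v : E n) :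
    ⟪sHess h u (tproj u v), tproj u v⟫ = ⟪sHess h u v, v⟫ := by
  have hu0 : u ≠ 0 := by rintro rfl; simp at hu
  have h1 : sHess h u (tproj u v) = sHess h u v := by
    rw [tproj_apply, map_sub, map_smul, sHess_apply_self hk1 hk2 hu0, smul_zero, sub_zero]
  rw [h1, inner_sHess_symm hk2 hu0, h1, ← inner_sHess_symm hk2 hu0]

theorem sMat_pos (hpos : ∀ u ∈ sphere (0 : E n) 1, ∀ v ∈ (ℝ ∙ u)ᗮ, v ≠ 0 → 0 < ⟪sHess h u v, v⟫)
    {u : E n} (hu : ‖u‖ = 1) {v : E n} (hv : v ≠ 0) : 0 < ⟪sMat h u v, v⟫ := by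
  rw [sMat_apply hk1 hk2 hu, inner_add_left, real_inner_smul_left,
    ← inner_sHess_tproj hk1 hk2 hu]
  by_cases h0 : tproj u v = 0
  · rw [h0, map_zero, inner_zero_left, zero_add]
    rw [tproj_apply, sub_eq_zero] at h0
    exact mul_self_pos.2 fun h1 => hv (by rw [h0, h1, zero_smul])
  · have := hpos u (by simpa using hu) _
      (Submodule.mem_orthogonal_singleton_iff_inner_right.2 (inner_tproj_of_unit hu v)) h0
    nlinarith [mul_self_nonneg ⟪u, v⟫]

theorem sdet_pos (hpos : ∀ u ∈ sphere (0 : E n) 1, ∀ v ∈ (ℝ ∙ u)ᗮ, v ≠ 0 → 0 < ⟪sHess h u v, v⟫)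
    {u : E n} (hu : ‖u‖ = 1) : 0 < sdet h u :=
  det_pos_of_inner_pos (sMat_symm hk1 hk2 hu) fun _ hv => sMat_pos hk1 hk2 hpos hu hv

omit hk1 in
theorem continuousOn_sMat : ContinuousOn (sMat h) (sphere (0 : E n) 1) := by
  have h1 : ContinuousOn (sHess h) (sphere (0 : E n) 1) :=
    (continuousOn_sHess hk2).mono fun x hx h0 => by
      rw [Set.mem_singleton_iff.1 h0] at hx; simp at hx
  refine ContinuousOn.add ?_ ?_
  · exact continuous_tproj.continuousOn.clm_comp (h1.clm_comp continuous_tproj.continuousOn)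
  · exact (((ContinuousLinearMap.smulRightL ℝ (E n) (E n)).continuous.comp
      (innerSL ℝ).continuous).clm_apply continuous_id).continuousOn

omit hk1 in
theorem continuousOn_sdet : ContinuousOn (sdet h) (sphere (0 : E n) 1) :=
  ContinuousLinearMap.continuous_det.comp_continuousOn (continuousOn_sMat hk2)

theorem exists_coercive
    (hpos : ∀ u ∈ sphere (0 : E n) 1, ∀ v ∈ (ℝ ∙ u)ᗮ, v ≠ 0 → 0 < ⟪sHess h u v, v⟫) :
    ∃ ε > 0, ∀ u : E n, ‖u‖ = 1 → ∀ v, 2 * ε * ‖tproj u v‖ ^ 2 ≤ ⟪sHess h u v, v⟫ := by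
  set K : Set (E n × E n) := (sphere 0 1 ×ˢ sphere 0 1) ∩ {p | ⟪p.1, p.2⟫ = 0} with hK
  have hKc : IsCompact K := ((isCompact_sphere _ _).prod (isCompact_sphere _ _)).inter_right
    (isClosed_eq (by fun_prop) continuous_const)
  have hcont : ContinuousOn (fun p : E n × E n => ⟪sHess h p.1 p.2, p.2⟫) K := by
    have h1 : ContinuousOn (fun p : E n × E n => sHess h p.1) K :=
      (continuousOn_sHess hk2).comp continuous_fst.continuousOn fun p hp h0 => by
        have := hp.1.1
        rw [Set.mem_singleton_iff.1 h0] at this; simp at this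
    exact (h1.clm_apply continuous_snd.continuousOn).inner continuous_snd.continuousOn
  obtain ⟨a, ha, hb⟩ := hKc.exists_forall_le' hcont (a := 0) fun p hp =>
    hpos p.1 hp.1.1 p.2 (Submodule.mem_orthogonal_singleton_iff_inner_right.2 hp.2)
      (fun h0 => by have := hp.1.2; rw [h0] at this; simp at this)
  refine ⟨a / 2, by positivity, fun u hu v => ?_⟩
  rw [← inner_sHess_tproj hk1 hk2 hu]
  set w := tproj u v with hw
  by_cases h0 : w = 0
  · simp [h0]
  have hw0 : 0 < ‖w‖ := norm_pos_iff.2 h0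
  have h1 := hb (u, ‖w‖⁻¹ • w) ⟨⟨by simpa using hu, by simp [norm_smul, hw0.ne']⟩, by
    simp [real_inner_smul_right, hw, inner_tproj_of_unit hu]⟩
  simp only [map_smul, real_inner_smul_left, real_inner_smul_right] at h1
  have h2 : ⟪sHess h u w, w⟫ = ‖w‖ ^ 2 * (‖w‖⁻¹ * (‖w‖⁻¹ * ⟪sHess h u w, w⟫)) := by
    field_simp
  rw [h2]
  nlinarith [sq_nonneg ‖w‖]

end Sphere

section Perturbation

variable {n : ℕ} {h : E n → ℝ} (hk1 : homog1 h) (hk2 : ContDiffOn ℝ 2 h {(0 : E n)}ᶜ)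

theorem hasFDerivAt_norm_of_ne_zero {x : E n} (hx : x ≠ 0) :
    HasFDerivAt (fun x : E n => ‖x‖) (‖x‖⁻¹ • innerSL ℝ x) x := by
  have := (hasStrictFDerivAt_norm_sq x).hasFDerivAt.sqrt (by simpa using hx)
  simp only [Real.sqrt_sq (norm_nonneg _)] at this
  refine this.congr_fderiv ?_
  ext v
  simp
  field_simp

include hk1 in
theorem homog1_sub_norm (c : ℝ) : homog1 (fun x => h x - c * ‖x‖) := fun t ht x => by
  simp only [hk1 t ht x, norm_smul, Real.norm_eq_abs, abs_of_pos ht]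
  ring

include hk2

theorem contDiffOn_sub_norm (c : ℝ) :
    ContDiffOn ℝ 2 (fun x => h x - c * ‖x‖) {(0 : E n)}ᶜ :=
  hk2.sub (contDiffOn_const.mul (contDiffOn_id.norm ℝ fun _ hx => hx))

theorem gradient_sub_norm (c : ℝ) {x : E n} (hx : x ≠ 0) :
    gradient (fun x => h x - c * ‖x‖) x = gradient h x - (c * ‖x‖⁻¹) • x := by
  refine HasGradientAt.gradient ?_
  rw [hasGradientAt_iff_hasFDerivAt]
  have h1 := (hasGradientAt_of_ne_zero hk2 hx).hasFDerivAt
  refine (h1.sub ((hasFDerivAt_norm_of_ne_zero hx).const_mul c)).congr_fderiv ?_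
  ext v
  simp [mul_assoc]

theorem sHess_sub_norm (c : ℝ) {u : E n} (hu : ‖u‖ = 1) :
    sHess (fun x => h x - c * ‖x‖) u = sHess h u - c • tproj u := by
  have hu0 : u ≠ 0 := by rintro rfl; simp at hu
  have h1 := hasFDerivAt_gradient (contDiffOn_sub_norm hk2 c) hu0
  have h2 : HasFDerivAt (fun x : E n => ‖x‖) (innerSL ℝ u) u := by
    simpa [hu] using hasFDerivAt_norm_of_ne_zero hu0
  have h3 := (hasFDerivAt_gradient hk2 hu0).sub
    (((((hasDerivAt_inv (norm_ne_zero_iff.2 hu0)).comp_hasFDerivAt u h2).const_mul c)).smul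
      (hasFDerivAt_id u))
  have h4 := (h3.congr_of_eventuallyEq (f₁ := gradient fun x => h x - c * ‖x‖) (by
    filter_upwards [isOpen_compl_singleton.mem_nhds hu0] with y hy
    simpa using gradient_sub_norm hk2 c hy))
  rw [h1.unique h4]
  ext1 v
  simp [tproj_apply, hu]
  module

include hk1

theorem inner_sHess_sub_norm_nonneg {ε c : ℝ} (hε : c ≤ ε)
    (hco : ∀ u : E n, ‖u‖ = 1 → ∀ v, ε * ‖tproj u v‖ ^ 2 ≤ ⟪sHess h u v, v⟫) {x : E n}
    (hx : x ≠ 0) (v : E n) : 0 ≤ ⟪sHess (fun x => h x - c * ‖x‖) x v, v⟫ := by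
  have hx0 : 0 < ‖x‖ := norm_pos_iff.2 hx
  have hu : ‖‖x‖⁻¹ • x‖ = 1 := by simp [norm_smul, hx0.ne']
  set u := ‖x‖⁻¹ • x with hudef
  have hu0 : u ≠ 0 := by rintro h0; simp [h0] at hu
  have hxu : x = ‖x‖ • u := by rw [hudef, smul_smul, mul_inv_cancel₀ hx0.ne', one_smul]
  rw [hxu, sHess_smul (homog1_sub_norm hk1 c) (contDiffOn_sub_norm hk2 c) hx0 hu0,
    sHess_sub_norm hk2 c hu, smul_apply, real_inner_smul_left]
  refine mul_nonneg (inv_nonneg.2 hx0.le) ?_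
  have h1 : ⟪tproj u v, v⟫ = ‖tproj u v‖ ^ 2 := by
    have h2 : v = tproj u v + ⟪u, v⟫ • u := by rw [tproj_apply, sub_add_cancel]
    calc ⟪tproj u v, v⟫ = ⟪tproj u v, tproj u v + ⟪u, v⟫ • u⟫ := by rw [← h2]
      _ = ‖tproj u v‖ ^ 2 := by
        rw [inner_add_right, real_inner_smul_right, real_inner_comm u, inner_tproj_of_unit hu,
          real_inner_self_eq_norm_sq, mul_zero, add_zero]
  have h2 := hco u hu v
  simp only [sub_apply, smul_apply, inner_sub_left, real_inner_smul_left, h1]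
  nlinarith [sq_nonneg ‖tproj u v‖]

end Perturbation

section ShiftedDeterminant

variable {n : ℕ} {h : E n → ℝ}

/-- The determinant of `(h_ij + h δ_ij) + s δ_ij`, i.e. the density of the volume of the parallel
body at distance `s`. -/
def shiftDet (h : E n → ℝ) (u : E n) (s : ℝ) : ℝ := (sMat h u + s • tproj u).det

theorem continuousOn_shiftDet (hk2 : ContDiffOn ℝ 2 h {(0 : E n)}ᶜ) :
    ContinuousOn (fun p : E n × ℝ => shiftDet h p.1 p.2) (sphere (0 : E n) 1 ×ˢ Set.univ) := by
  refine ContinuousLinearMap.continuous_det.comp_continuousOn (ContinuousOn.add ?_ ?_)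
  · exact (continuousOn_sMat hk2).comp continuous_fst.continuousOn fun p hp => hp.1
  · exact (continuous_snd.smul (continuous_tproj.comp continuous_fst)).continuousOn

/-- The Jacobian of `y ↦ ∇(h - ε|·|)(y) + y` in polar coordinates. -/
theorem pow_mul_det_eq_shiftDet (hk1 : homog1 h) (hk2 : ContDiffOn ℝ 2 h {(0 : E n)}ᶜ) (hn : 1 ≤ n)
    (ε : ℝ) {u : E n} (hu : ‖u‖ = 1) {r : ℝ} (hr : 0 < r) :
    r ^ (n - 1) * (sHess (fun x => h x - ε * ‖x‖) (r • u) + ContinuousLinearMap.id ℝ (E n)).det =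
      shiftDet h u (r - ε) := by
  have hu0 : u ≠ 0 := by rintro rfl; simp at hu
  rw [sHess_smul (homog1_sub_norm hk1 ε) (contDiffOn_sub_norm hk2 ε) hr hu0,
    sHess_sub_norm hk2 ε hu]
  have h1 : ((r⁻¹ • (sHess h u - ε • tproj u) + ContinuousLinearMap.id ℝ (E n) :
      E n →L[ℝ] E n) : E n →ₗ[ℝ] E n) = r⁻¹ • (LinearMap.transvection
        (innerSL ℝ u : E n →ₗ[ℝ] ℝ) ((r - 1) • u)).comp
        ((sMat h u + (r - ε) • tproj u : E n →L[ℝ] E n) : E n →ₗ[ℝ] E n) := by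
    ext1 v
    have h2 : ⟪u, sHess h u v⟫ = 0 := by
      rw [← inner_sHess_symm hk2 hu0, sHess_apply_self hk1 hk2 hu0, inner_zero_left]
    have h3 : ⟪u, u⟫ = 1 := by rw [real_inner_self_eq_norm_sq, hu, one_pow]
    simp [sMat_apply hk1 hk2 hu, LinearMap.transvection.apply, inner_add_right,
      real_inner_smul_right, h2, inner_tproj_of_unit hu, hu]
    rw [tproj_apply]
    match_scalars <;> field_simp <;> ring
  rw [ContinuousLinearMap.det, h1, LinearMap.det_smul, LinearMap.det_comp,
    LinearMap.transvection.det, finrank_euclideanSpace_fin, shiftDet, ContinuousLinearMap.det]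
  have h3 : (innerSL ℝ u : E n →ₗ[ℝ] ℝ) ((r - 1) • u) = r - 1 := by
    simp [hu]
  rw [h3]
  obtain ⟨m, rfl⟩ : ∃ m, n = m + 1 := ⟨n - 1, by omega⟩
  simp only [Nat.add_sub_cancel, pow_succ, inv_pow]
  field_simp
  ring

variable (hk1 : homog1 h) (hk2 : ContDiffOn ℝ 2 h {(0 : E n)}ᶜ)
  (hpos : ∀ u ∈ sphere (0 : E n) 1, ∀ v ∈ (ℝ ∙ u)ᗮ, v ≠ 0 → 0 < ⟪sHess h u v, v⟫)
  {Cof : E n → E n →L[ℝ] E n}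
  (hCtan : ∀ u ∈ sphere (0 : E n) 1, ∀ v : E n, Cof u v ∈ (ℝ ∙ u)ᗮ)
  (hCinv : ∀ u ∈ sphere (0 : E n) 1, (sHess h u).comp (Cof u) = sdet h u • tproj u)

include hk1 hk2 hCtan hCinv

theorem sMat_mul_cofactor {u : E n} (hu : u ∈ sphere (0 : E n) 1) :
    sMat h u * Cof u = sdet h u • tproj u := by
  ext1 v
  have h1 : ⟪u, Cof u v⟫ = 0 :=
    Submodule.mem_orthogonal_singleton_iff_inner_right.1 (hCtan u hu v)
  rw [← hCinv u hu, mul_apply_eq_comp, sMat_apply hk1 hk2 (by simpa using hu), h1,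
    zero_smul, add_zero, ContinuousLinearMap.comp_apply]

include hpos

theorem continuousOn_cofactor : ContinuousOn Cof (sphere (0 : E n) 1) := by
  have hunit : ∀ u ∈ sphere (0 : E n) 1, IsUnit (sMat h u) := by
    intro u hu
    rw [ContinuousLinearMap.isUnit_iff_bijective]
    exact (ContinuousLinearMap.toContinuousLinearEquivOfDetNeZero (sMat h u)
      (sdet_pos hk1 hk2 hpos (by simpa using hu)).ne').bijective
  have h1 : ContinuousOn (fun u => Ring.inverse (sMat h u) * (sdet h u • tproj u))
      (sphere (0 : E n) 1) := by
    refine ContinuousOn.mul (fun u hu => ?_)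
      ((continuousOn_sdet hk2).smul continuous_tproj.continuousOn)
    obtain ⟨a, ha⟩ := hunit u hu
    have := NormedRing.inverse_continuousAt a
    rw [ha] at this
    exact this.comp_continuousWithinAt (continuousOn_sMat hk2 u hu)
  refine h1.congr fun u hu => ?_
  simp only
  rw [← sMat_mul_cofactor hk1 hk2 hCtan hCinv hu, ← mul_assoc,
    Ring.inverse_mul_cancel _ (hunit u hu), one_mul]

theorem shiftDet_eq_sdet_mul {u : E n} (hu : u ∈ sphere (0 : E n) 1) (s : ℝ) :
    shiftDet h u s = sdet h u * (1 + s • (sdet h u)⁻¹ • Cof u).det := by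
  have h0 : sdet h u ≠ 0 := (sdet_pos hk1 hk2 hpos (by simpa using hu)).ne'
  have h1 : sMat h u + s • tproj u = sMat h u * (1 + s • (sdet h u)⁻¹ • Cof u) := by
    have h2 : sMat h u * (s • (sdet h u)⁻¹ • Cof u) = s • (sdet h u)⁻¹ • (sMat h u * Cof u) := by
      ext1 v; simp
    rw [mul_add, mul_one, h2, sMat_mul_cofactor hk1 hk2 hCtan hCinv hu, inv_smul_smul₀ h0]
  rw [shiftDet, h1, sdet_eq, ContinuousLinearMap.det, ContinuousLinearMap.det,
    ContinuousLinearMap.det, ← LinearMap.det_comp]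
  rfl

/-- First order expansion of the density of the volume of parallel bodies. -/
theorem exists_abs_shiftDet_sub_le {κ : ℝ} (hκ : 0 < κ) : ∃ ρ > 0, ∀ u ∈ sphere (0 : E n) 1,
    ∀ s : ℝ, |s| ≤ ρ → |(|shiftDet h u s| - (sdet h u +
      s * LinearMap.trace ℝ (E n) (Cof u : E n →ₗ[ℝ] E n)))| ≤ κ * |s| := by
  have hc := continuousOn_cofactor hk1 hk2 hpos hCtan hCinv
  obtain ⟨C, hC⟩ := (isCompact_sphere (0 : E n) 1).exists_bound_of_continuousOn hc
  obtain ⟨D, hD⟩ := (isCompact_sphere (0 : E n) 1).exists_bound_of_continuousOn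
    (continuousOn_sdet hk2)
  obtain ⟨d, hd0, hd⟩ := (isCompact_sphere (0 : E n) 1).exists_forall_le'
    (continuousOn_sdet hk2) (a := 0) fun u hu => sdet_pos hk1 hk2 hpos (by simpa using hu)
  set L : (E n →L[ℝ] E n) →L[ℝ] ℝ := LinearMap.toContinuousLinearMap
    ((LinearMap.trace ℝ (E n)).comp (ContinuousLinearMap.coeLM ℝ)) with hL
  have hLapp : ∀ A : E n →L[ℝ] E n, L A = LinearMap.trace ℝ (E n) (A : E n →ₗ[ℝ] E n) :=
    fun A => rfl
  set C' := max C 0 + 1 with hC'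
  have hC'0 : 0 < C' := by positivity
  obtain ⟨ρ, hρ, hb⟩ := exists_abs_det_one_add_sub_le (n := n) (κ := κ / C') (by positivity)
  refine ⟨min (ρ * d / (2 * C')) (d / (2 * (‖L‖ * C' + 1))), by positivity, fun u hu s hs => ?_⟩
  have hdu := hd u hu
  have hd1 : 0 < sdet h u := hd0.trans_le hdu
  have hCu : ‖Cof u‖ ≤ C' := (hC u hu).trans (by rw [hC']; linarith [le_max_left C 0])
  set N := s • (sdet h u)⁻¹ • Cof u with hN
  have hNn : ‖N‖ = |s| * ((sdet h u)⁻¹ * ‖Cof u‖) := by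
    rw [hN, norm_smul, norm_smul, Real.norm_eq_abs, Real.norm_eq_abs, abs_of_pos (inv_pos.2 hd1)]
  have hNlt : ‖N‖ < ρ := by
    have h1 : |s| ≤ ρ * d / (2 * C') := hs.trans (min_le_left _ _)
    rw [le_div_iff₀ (by positivity)] at h1
    rw [hNn, ← mul_assoc, mul_comm |s|, mul_assoc, inv_mul_lt_iff₀ hd1]
    nlinarith [abs_nonneg s, norm_nonneg (Cof u), mul_le_mul_of_nonneg_left hCu (abs_nonneg s),
      mul_le_mul_of_nonneg_left hdu hρ.le, mul_pos hρ hd0]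
  have htr : sdet h u * L N = s * L (Cof u) := by
    rw [hN, map_smul, map_smul, smul_eq_mul, smul_eq_mul]
    field_simp
  have hnn : 0 ≤ sdet h u + s * L (Cof u) := by
    have h1 : |s| ≤ d / (2 * (‖L‖ * C' + 1)) := hs.trans (min_le_right _ _)
    rw [le_div_iff₀ (by positivity)] at h1
    have h2 : |L (Cof u)| ≤ ‖L‖ * C' := (L.le_opNorm _).trans (by gcongr)
    have h3 : |s * L (Cof u)| ≤ |s| * (‖L‖ * C') := by
      rw [abs_mul]; gcongr
    have := neg_abs_le (s * L (Cof u))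
    nlinarith [abs_nonneg s]
  rw [shiftDet_eq_sdet_mul hk1 hk2 hpos hCtan hCinv hu, ← hLapp]
  have h1 := hb N hNlt
  rw [← hLapp] at h1
  calc |(|sdet h u * (1 + N).det| - (sdet h u + s * L (Cof u)))|
      = |(|sdet h u * (1 + N).det| - |sdet h u + s * L (Cof u)|)| := by rw [abs_of_nonneg hnn]
    _ ≤ |sdet h u * (1 + N).det - (sdet h u + s * L (Cof u))| := abs_abs_sub_abs_le _ _
    _ = sdet h u * |(1 + N).det - 1 - L N| := by
        rw [← htr, ← abs_of_pos hd1, ← abs_mul, abs_of_pos hd1]; congr 1; ring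
    _ ≤ sdet h u * (κ / C' * ‖N‖) := by gcongr
    _ = κ / C' * ‖Cof u‖ * |s| := by rw [hNn]; field_simp
    _ ≤ κ / C' * C' * |s| := by gcongr
    _ = κ * |s| := by field_simp

end ShiftedDeterminant

theorem lintegral_eq_lintegral_sphere {n : ℕ} (hn : 1 ≤ n) {f : E n → ℝ≥0∞} (hf : Measurable f) :
    ∫⁻ y, f y = ∫⁻ u : sphere (0 : E n) 1, (∫⁻ r in Set.Ioi (0 : ℝ),
      ENNReal.ofReal (r ^ (n - 1)) * f (r • (u : E n))) ∂(volume : Measure (E n)).toSphere := by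
  have : Nonempty (Fin n) := ⟨⟨0, hn⟩⟩
  have h1 : ∫⁻ y, f y = ∫⁻ y in ({0}ᶜ : Set (E n)), f y := by
    rw [restrict_compl_singleton]
  have hmp := (volume : Measure (E n)).measurePreserving_homeomorphUnitSphereProd
  have h2 := hmp.lintegral_comp_emb (Homeomorph.measurableEmbedding _)
    (fun p => f ((p.2 : ℝ) • (p.1 : E n)))
  have h3 : ∀ y : ({0}ᶜ : Set (E n)), f (((homeomorphUnitSphereProd (E n) y).2 : ℝ) •
      ((homeomorphUnitSphereProd (E n) y).1 : E n)) = f y := by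
    intro y
    have hy : ‖(y : E n)‖ ≠ 0 := norm_ne_zero_iff.2 y.2
    rw [homeomorphUnitSphereProd_apply_snd_coe, homeomorphUnitSphereProd_apply_fst_coe, smul_smul,
      mul_inv_cancel₀ hy, one_smul]
  simp only [h3] at h2
  rw [h1, ← lintegral_subtype_comap (measurableSet_singleton (0 : E n)).compl, h2,
    lintegral_prod _ (by fun_prop)]
  refine lintegral_congr fun u => ?_
  rw [finrank_euclideanSpace_fin, Measure.volumeIoiPow,
    lintegral_withDensity_eq_lintegral_mul _ (by fun_prop) (by fun_prop)]
  exact lintegral_subtype_comap measurableSet_Ioi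
    (fun r : ℝ => ENNReal.ofReal (r ^ (n - 1)) * f (r • (u : E n)))

section ParallelBody

variable {n : ℕ}

/-- The convex body with support function `h - ε|·|`. -/
def innerBody (h : E n → ℝ) (ε : ℝ) : Set (E n) :=
  {x | ∀ u ∈ sphere (0 : E n) 1, ⟪x, u⟫ ≤ h u - ε}

/-- In polar coordinates, the parametrization of the exterior of `innerBody h ε` by normal
rays. -/
def rayMap (h : E n → ℝ) (ε : ℝ) (y : E n) : E n := gradient (fun x => h x - ε * ‖x‖) y + y

/-- The star-shaped domain with radial function `ε + ψ`, without the origin. -/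
def rayDomain (ε : ℝ) (ψ : E n → ℝ) : Set (E n) := {y | y ≠ 0 ∧ ‖y‖ ≤ ε + ψ (‖y‖⁻¹ • y)}

/-- The body whose boundary is at distance `ψ` from that of the body with support function `h`. -/
def rayBody (h : E n → ℝ) (ε : ℝ) (ψ : E n → ℝ) : Set (E n) :=
  innerBody h ε ∪ rayMap h ε '' rayDomain ε ψ

theorem measurableSet_rayDomain (ε : ℝ) {ψ : E n → ℝ} (hψ : ContinuousOn ψ (sphere (0 : E n) 1)) :
    MeasurableSet (rayDomain ε ψ) := by
  have h1 : ContinuousOn (fun y : E n => ‖y‖ - ψ (‖y‖⁻¹ • y)) {0}ᶜ := by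
    refine continuous_norm.continuousOn.sub (hψ.comp (fun y hy => ?_) fun y hy => ?_)
    · exact ((continuous_norm.continuousAt.inv₀ (norm_ne_zero_iff.2 hy)).smul
        continuousAt_id).continuousWithinAt
    · have : ‖y‖ ≠ 0 := norm_ne_zero_iff.2 hy
      simp [norm_smul, this]
  obtain ⟨V, hV, hVeq⟩ := continuousOn_iff_isClosed.1 h1 (Set.Iic ε) isClosed_Iic
  have h2 : rayDomain ε ψ = V ∩ {0}ᶜ := by
    rw [← hVeq]
    ext y
    simp only [rayDomain, Set.mem_ofPred_eq, Set.mem_inter_iff, Set.mem_preimage, Set.mem_Iic,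
      Set.mem_compl_iff, Set.mem_singleton_iff, tsub_le_iff_right]
    exact and_comm
  rw [h2]
  exact hV.measurableSet.inter (measurableSet_singleton _).compl

variable {h : E n → ℝ} (hn : 2 ≤ n) (hk1 : homog1 h) (hk2 : ContDiffOn ℝ 2 h {(0 : E n)}ᶜ)

theorem isClosed_innerBody (ε : ℝ) : IsClosed (innerBody h ε) := by
  have : innerBody h ε = ⋂ u ∈ sphere (0 : E n) 1, {x | ⟪x, u⟫ ≤ h u - ε} := by
    ext x; simp [innerBody]
  rw [this]
  exact isClosed_biInter fun u _ => isClosed_le (by fun_prop) continuous_const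

include hk2 in
theorem continuousOn_sphere_of_contDiffOn : ContinuousOn h (sphere (0 : E n) 1) :=
  hk2.continuousOn.mono fun x hx h0 => by
    rw [Set.mem_singleton_iff.1 h0] at hx; simp at hx

include hk2 in
theorem volume_innerBody_lt_top (ε : ℝ) : volume (innerBody h ε) < ⊤ := by
  obtain ⟨C, hC⟩ := (isCompact_sphere (0 : E n) 1).exists_bound_of_continuousOn
    (continuousOn_sphere_of_contDiffOn hk2)
  refine (measure_mono (t := closedBall 0 (max (C - ε) 0)) fun x hx => ?_).trans_lt
    measure_closedBall_lt_top
  rw [mem_closedBall_zero_iff]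
  rcases eq_or_ne x 0 with rfl | h0
  · simp
  have hx0 : ‖x‖ ≠ 0 := norm_ne_zero_iff.2 h0
  have hu : ‖x‖⁻¹ • x ∈ sphere (0 : E n) 1 := by simp [norm_smul, hx0]
  have h1 := hx _ hu
  rw [real_inner_smul_right, real_inner_self_eq_norm_sq, sq, ← mul_assoc, inv_mul_cancel₀ hx0,
    one_mul] at h1
  have h2 := (le_abs_self _).trans (hC _ hu)
  exact le_max_of_le_left (by linarith)

include hk2 in
theorem hasFDerivAt_rayMap (ε : ℝ) {y : E n} (hy : y ≠ 0) :
    HasFDerivAt (rayMap h ε) (sHess (fun x => h x - ε * ‖x‖) y + ContinuousLinearMap.id ℝ (E n))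
      y :=
  (hasFDerivAt_gradient (contDiffOn_sub_norm hk2 ε) hy).add (hasFDerivAt_id y)

include hk1 hk2 in
theorem rayMap_smul (ε : ℝ) {u : E n} (hu : ‖u‖ = 1) {r : ℝ} (hr : 0 < r) :
    rayMap h ε (r • u) = gradient h u + (r - ε) • u := by
  have hu0 : u ≠ 0 := by rintro rfl; simp at hu
  rw [rayMap, gradient_smul (homog1_sub_norm hk1 ε) (contDiffOn_sub_norm hk2 ε) hr hu0,
    gradient_sub_norm hk2 ε hu0, hu]
  module

section Coercive

variable {ε : ℝ} (hco : ∀ u : E n, ‖u‖ = 1 → ∀ v, ε * ‖tproj u v‖ ^ 2 ≤ ⟪sHess h u v, v⟫)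

include hn hk1 hk2 hco in
theorem injOn_rayMap : Set.InjOn (rayMap h ε) {0}ᶜ := by
  intro x hx y hy hxy
  set k : E n → ℝ := fun x => h x - ε * ‖x‖ with hk
  have k1 := homog1_sub_norm hk1 ε
  have k2 := contDiffOn_sub_norm hk2 ε
  have kpos := fun (x : E n) (hx : x ≠ 0) => inner_sHess_sub_norm_nonneg hk1 hk2 le_rfl hco hx
  have h1 := inner_gradient_le hn k1 k2 kpos hx hy
  have h2 := inner_gradient_le hn k1 k2 kpos hy hx
  have h3 := inner_gradient_self k1 k2 hx
  have h4 := inner_gradient_self k1 k2 hy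
  have h5 : gradient k x - gradient k y = y - x := by
    have : gradient k x + x = gradient k y + y := hxy
    rw [sub_eq_sub_iff_add_eq_add, this, add_comm]
  have h6 : ⟪gradient k x - gradient k y, y - x⟫ ≤ 0 := by
    rw [inner_sub_left, inner_sub_right, inner_sub_right, h3, h4]
    linarith
  rw [h5, real_inner_self_eq_norm_sq] at h6
  have h7 : ‖y - x‖ = 0 := by nlinarith [norm_nonneg (y - x)]
  exact (sub_eq_zero.1 (norm_eq_zero.1 h7)).symm

include hk1 hk2 in
theorem disjoint_innerBody_rayMap (ε : ℝ) {s : Set (E n)} (hs : s ⊆ {0}ᶜ) :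
    Disjoint (innerBody h ε) (rayMap h ε '' s) := by
  rw [Set.disjoint_right]
  rintro _ ⟨y, hy, rfl⟩ hmem
  have hy0 : 0 < ‖y‖ := norm_pos_iff.2 (hs hy)
  have hu : ‖‖y‖⁻¹ • y‖ = 1 := by simp [norm_smul, hy0.ne']
  set u := ‖y‖⁻¹ • y with hudef
  have hyu : y = ‖y‖ • u := by rw [hudef, smul_smul, mul_inv_cancel₀ hy0.ne', one_smul]
  have hu0 : u ≠ 0 := by rintro h0; simp [h0] at hu
  have h1 := hmem u (by simpa using hu)
  rw [hyu, rayMap_smul hk1 hk2 ε hu hy0, inner_add_left, inner_gradient_self hk1 hk2 hu0,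
    real_inner_smul_left, real_inner_self_eq_norm_sq, hu] at h1
  linarith

include hn hk1 hk2 in
theorem mem_rayBody_of_inner_le {ψ : E n → ℝ} {z : E n}
    (hz : ∀ u ∈ sphere (0 : E n) 1, ⟪z, u⟫ ≤ h u + ψ u) : z ∈ rayBody h ε ψ := by
  by_cases hzK : z ∈ innerBody h ε
  · exact .inl hzK
  right
  set k : E n → ℝ := fun x => h x - ε * ‖x‖ with hk
  have k1 : homog1 k := homog1_sub_norm hk1 ε
  have k2 : ContDiffOn ℝ 2 k {0}ᶜ := contDiffOn_sub_norm hk2 ε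
  have : Nonempty (Fin n) := ⟨⟨0, by omega⟩⟩
  obtain ⟨u, hu, hmax⟩ := (isCompact_sphere (0 : E n) 1).exists_isMaxOn
    (NormedSpace.sphere_nonempty.2 zero_le_one)
    (f := fun u => ⟪z, u⟫ - k u) (ContinuousOn.sub (by fun_prop)
      (continuousOn_sphere_of_contDiffOn k2))
  have hu1 : ‖u‖ = 1 := by simpa using hu
  have hu0 : u ≠ 0 := by rintro rfl; simp at hu1
  set r := ⟪z, u⟫ - k u with hr
  have hr0 : 0 < r := by
    simp only [innerBody, Set.mem_ofPred_eq, not_forall, not_le] at hzK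
    obtain ⟨v, hv, hlt⟩ := hzK
    have h1 : ⟪z, v⟫ - k v ≤ r := hmax hv
    have hv1 : ‖v‖ = 1 := by simpa using hv
    simp only [hk, hv1] at h1
    linarith
  have hloc : IsLocalMax (fun y => ⟪z, y⟫ - k y - r * ‖y‖) u := by
    filter_upwards [isOpen_compl_singleton.mem_nhds hu0] with y hy
    have hy0 : 0 < ‖y‖ := norm_pos_iff.2 hy
    have hw : ‖y‖⁻¹ • y ∈ sphere (0 : E n) 1 := by simp [norm_smul, hy0.ne']
    have h1 : ⟪z, ‖y‖⁻¹ • y⟫ - k (‖y‖⁻¹ • y) ≤ r := hmax hw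
    rw [k1 _ (inv_pos.2 hy0), real_inner_smul_right, ← mul_sub, inv_mul_le_iff₀ hy0] at h1
    rw [hu1]
    linarith
  have hderiv : HasFDerivAt (fun y => ⟪z, y⟫ - k y - r * ‖y‖)
      (innerSL ℝ z - InnerProductSpace.toDual ℝ (E n) (gradient k u) - r • ‖u‖⁻¹ • innerSL ℝ u)
      u :=
    (((innerSL ℝ z).hasFDerivAt (x := u)).sub (hasGradientAt_of_ne_zero k2 hu0).hasFDerivAt).sub
      ((hasFDerivAt_norm_of_ne_zero hu0).const_mul r)
  have hzero := hloc.hasFDerivAt_eq_zero hderiv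
  have hz' : z = rayMap h ε (r • u) := by
    rw [rayMap, gradient_smul k1 k2 hr0 hu0]
    refine ext_inner_right ℝ fun v => ?_
    have h1 := congrArg (fun L => L v) hzero
    simp [hu1, -inner_gradient_left] at h1
    rw [inner_add_left, real_inner_smul_left, inner_gradient_eq_fderiv]
    linarith
  refine ⟨r • u, ⟨smul_ne_zero hr0.ne' hu0, ?_⟩, hz'.symm⟩
  have h1 := hz u hu
  have h2 : ‖r • u‖ = r := by rw [norm_smul, hu1, mul_one, Real.norm_of_nonneg hr0.le]
  rw [h2, inv_smul_smul₀ hr0.ne']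
  have h3 : k u = h u - ε := by simp [hk, hu1]
  linarith

include hn hk1 hk2 hco in
theorem measurableSet_rayBody {ψ : E n → ℝ} (hψ : ContinuousOn ψ (sphere (0 : E n) 1)) :
    MeasurableSet (rayBody h ε ψ) :=
  (isClosed_innerBody ε).measurableSet.union (measurable_image_of_fderivWithin
    (measurableSet_rayDomain ε hψ) (fun _ hy => (hasFDerivAt_rayMap hk2 ε hy.1).hasFDerivWithinAt)
    ((injOn_rayMap hn hk1 hk2 hco).mono fun _ hy => hy.1))

end Coercive

end ParallelBody

section VolumeFormula

variable {n : ℕ} {h : E n → ℝ} (hn : 2 ≤ n) (hk1 : homog1 h)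
  (hk2 : ContDiffOn ℝ 2 h {(0 : E n)}ᶜ)

/-- The signed volume between the boundaries of the body with support function `h` and of the
one at distance `ψ`. -/
def shellVolume (h ψ : E n → ℝ) : ℝ :=
  ∫ u : sphere (0 : E n) 1, (∫ s in (0 : ℝ)..ψ u, |shiftDet h u s|)
    ∂(volume : Measure (E n)).toSphere

include hk2 in
theorem continuous_abs_shiftDet :
    Continuous (Function.uncurry fun (u : sphere (0 : E n) 1) (s : ℝ) => |shiftDet h u s|) := by
  refine continuous_abs.comp ?_
  exact (continuousOn_shiftDet hk2).comp_continuous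
    (f := fun p : sphere (0 : E n) 1 × ℝ => ((p.1 : E n), p.2)) (by fun_prop)
    fun p => ⟨p.1.2, Set.mem_univ _⟩

include hk2 in
theorem continuous_integral_abs_shiftDet {ψ : E n → ℝ}
    (hψ : ContinuousOn ψ (sphere (0 : E n) 1)) :
    Continuous fun u : sphere (0 : E n) 1 => ∫ s in (0 : ℝ)..ψ u, |shiftDet h u s| :=
  intervalIntegral.continuous_parametric_intervalIntegral_of_continuous
    (continuous_abs_shiftDet hk2) hψ.domRestrict

include hk2 in
theorem intervalIntegrable_abs_shiftDet (u : sphere (0 : E n) 1) (a b : ℝ) :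
    IntervalIntegrable (fun s => |shiftDet h u s|) volume a b :=
  Continuous.intervalIntegrable
    ((continuous_abs_shiftDet hk2).comp (f := fun s : ℝ => (u, s)) (by fun_prop)) a b

theorem integrable_toSphere_of_continuous {f : sphere (0 : E n) 1 → ℝ} (hf : Continuous f) :
    Integrable f (volume : Measure (E n)).toSphere :=
  hf.integrable_of_hasCompactSupport (HasCompactSupport.of_compactSpace f)

include hk2 in
theorem shellVolume_sub {ψ χ : E n → ℝ} (hψ : ContinuousOn ψ (sphere (0 : E n) 1))
    (hχ : ContinuousOn χ (sphere (0 : E n) 1)) :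
    shellVolume h ψ - shellVolume h χ =
      ∫ u : sphere (0 : E n) 1, (∫ s in χ u..ψ u, |shiftDet h u s|)
        ∂(volume : Measure (E n)).toSphere := by
  rw [shellVolume, shellVolume, ← integral_sub
    (integrable_toSphere_of_continuous (continuous_integral_abs_shiftDet hk2 hψ))
    (integrable_toSphere_of_continuous (continuous_integral_abs_shiftDet hk2 hχ))]
  refine integral_congr_ae (.of_forall fun u => ?_)
  exact intervalIntegral.integral_interval_sub_left (intervalIntegrable_abs_shiftDet hk2 u _ _)
    (intervalIntegrable_abs_shiftDet hk2 u _ _)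

variable {ε : ℝ} (hco : ∀ u : E n, ‖u‖ = 1 → ∀ v, ε * ‖tproj u v‖ ^ 2 ≤ ⟪sHess h u v, v⟫)

include hn hk1 hk2 in
theorem lintegral_rayDomain_eq {ψ : E n → ℝ} (hψ : ContinuousOn ψ (sphere (0 : E n) 1))
    (hεψ : ∀ u ∈ sphere (0 : E n) 1, 0 ≤ ε + ψ u) :
    ∫⁻ y in rayDomain ε ψ, ENNReal.ofReal
        |(sHess (fun x => h x - ε * ‖x‖) y + ContinuousLinearMap.id ℝ (E n)).det| =
      ENNReal.ofReal (shellVolume h ψ - shellVolume h fun _ => -ε) := by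
  set D : E n → ℝ≥0∞ := fun y => ENNReal.ofReal
    |(sHess (fun x => h x - ε * ‖x‖) y + ContinuousLinearMap.id ℝ (E n)).det| with hD
  have hDm : Measurable D := by
    refine measurable_of_continuousOn_compl_singleton 0 ?_
    refine ENNReal.continuous_ofReal.comp_continuousOn (continuous_abs.comp_continuousOn ?_)
    exact contDiff_continuousLinearMap_det.continuous.comp_continuousOn
      ((continuousOn_sHess (contDiffOn_sub_norm hk2 ε)).add continuousOn_const)
  have hdom := measurableSet_rayDomain ε hψ
  rw [← lintegral_indicator hdom, lintegral_eq_lintegral_sphere (by omega) (hDm.indicator hdom),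
    shellVolume_sub hk2 hψ continuousOn_const, ofReal_integral_eq_lintegral_ofReal]
  · refine lintegral_congr fun u => ?_
    have hu : ‖(u : E n)‖ = 1 := by simp
    have hu0 : (u : E n) ≠ 0 := fun h0 => by simp [h0] at hu
    have hle := hεψ u u.2
    have h1 : ∀ r ∈ Set.Ioi (0 : ℝ), ENNReal.ofReal (r ^ (n - 1)) *
        (rayDomain ε ψ).indicator D (r • (u : E n)) =
        (Set.Iic (ε + ψ u)).indicator (fun r => ENNReal.ofReal |shiftDet h u (r - ε)|) r := by
      intro r hr
      have hr' : (0 : ℝ) < r := hr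
      have hmem : r • (u : E n) ∈ rayDomain ε ψ ↔ r ∈ Set.Iic (ε + ψ u) := by
        have h2 : ‖r • (u : E n)‖ = r := by
          rw [norm_smul, hu, mul_one, Real.norm_of_nonneg hr'.le]
        simp only [rayDomain, Set.mem_ofPred_eq, h2, inv_smul_smul₀ hr'.ne', Set.mem_Iic]
        exact and_iff_right (smul_ne_zero hr'.ne' hu0)
      by_cases hm : r ∈ Set.Iic (ε + ψ u)
      · rw [Set.indicator_of_mem hm, Set.indicator_of_mem (hmem.2 hm), hD,
          ← ENNReal.ofReal_mul (by positivity), ← pow_mul_det_eq_shiftDet hk1 hk2 (by omega) ε hu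
          hr', abs_mul, abs_of_nonneg (a := r ^ (n - 1)) (by positivity)]
      · rw [Set.indicator_of_notMem hm, Set.indicator_of_notMem (mt hmem.1 hm), mul_zero]
    rw [setLIntegral_congr_fun measurableSet_Ioi h1, lintegral_indicator measurableSet_Iic,
      Measure.restrict_restrict measurableSet_Iic, Set.Iic_inter_Ioi]
    have h3 := intervalIntegral.integral_comp_sub_right (fun s => |shiftDet h u s|) ε
      (a := 0) (b := ε + ψ u)
    rw [zero_sub, add_sub_cancel_left] at h3
    rw [← h3, intervalIntegral.integral_of_le hle, ofReal_integral_eq_lintegral_ofReal]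
    · have h4 : Continuous fun r : ℝ => |shiftDet h u (r - ε)| :=
        (continuous_abs_shiftDet hk2).comp (f := fun r : ℝ => (u, r - ε)) (by fun_prop)
      exact (h4.intervalIntegrable 0 (ε + ψ u)).1
    · exact .of_forall fun _ => abs_nonneg _
  · have h5 := (continuous_integral_abs_shiftDet hk2 hψ).sub
      (continuous_integral_abs_shiftDet hk2 (ψ := fun _ => -ε) continuousOn_const)
    refine integrable_toSphere_of_continuous (h5.congr fun u => ?_)
    exact intervalIntegral.integral_interval_sub_left (intervalIntegrable_abs_shiftDet hk2 u _ _)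
      (intervalIntegrable_abs_shiftDet hk2 u _ _)
  · exact .of_forall fun u => intervalIntegral.integral_nonneg (by linarith [hεψ u u.2])
      fun _ _ => abs_nonneg _

include hk2 in
theorem shellVolume_mono {ψ χ : E n → ℝ} (hψ : ContinuousOn ψ (sphere (0 : E n) 1))
    (hχ : ContinuousOn χ (sphere (0 : E n) 1)) (hle : ∀ u ∈ sphere (0 : E n) 1, χ u ≤ ψ u) :
    shellVolume h χ ≤ shellVolume h ψ := by
  rw [← sub_nonneg, shellVolume_sub hk2 hψ hχ]
  exact integral_nonneg fun u => intervalIntegral.integral_nonneg (hle u u.2)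
    fun _ _ => abs_nonneg _

include hn hk1 hk2 hco in
theorem volume_rayBody {ψ : E n → ℝ} (hψ : ContinuousOn ψ (sphere (0 : E n) 1))
    (hεψ : ∀ u ∈ sphere (0 : E n) 1, 0 ≤ ε + ψ u) :
    volume (rayBody h ε ψ) = volume (innerBody h ε) +
      ENNReal.ofReal (shellVolume h ψ - shellVolume h fun _ => -ε) := by
  have hsub : rayDomain ε ψ ⊆ {0}ᶜ := fun _ hy => hy.1
  have hdom := measurableSet_rayDomain ε hψ
  have hinj := (injOn_rayMap hn hk1 hk2 hco).mono hsub
  have hder : ∀ y ∈ rayDomain ε ψ, HasFDerivWithinAt (rayMap h ε)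
      (sHess (fun x => h x - ε * ‖x‖) y + ContinuousLinearMap.id ℝ (E n)) (rayDomain ε ψ) y :=
    fun _ hy => (hasFDerivAt_rayMap hk2 ε hy.1).hasFDerivWithinAt
  rw [rayBody, measure_union (disjoint_innerBody_rayMap hk1 hk2 ε hsub)
    (measurable_image_of_fderivWithin hdom hder hinj),
    ← lintegral_abs_det_fderiv_eq_addHaar_image volume hdom hder hinj,
    lintegral_rayDomain_eq hn hk1 hk2 hψ hεψ]

include hn hk1 hk2 hco in
theorem min_shellVolume_le {ψ₁ ψ₂ ψ₃ : E n → ℝ}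
    (h₁ : ContinuousOn ψ₁ (sphere (0 : E n) 1)) (h₂ : ContinuousOn ψ₂ (sphere (0 : E n) 1))
    (h₃ : ContinuousOn ψ₃ (sphere (0 : E n) 1))
    (hε₁ : ∀ u ∈ sphere (0 : E n) 1, 0 ≤ ε + ψ₁ u) (hε₂ : ∀ u ∈ sphere (0 : E n) 1, 0 ≤ ε + ψ₂ u)
    (hε₃ : ∀ u ∈ sphere (0 : E n) 1, 0 ≤ ε + ψ₃ u)
    (hmid : ∀ a ∈ rayBody h ε ψ₁, ∀ b ∈ rayBody h ε ψ₂, ∀ u ∈ sphere (0 : E n) 1,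
      ⟪(1 / 2 : ℝ) • (a + b), u⟫ ≤ h u + ψ₃ u) :
    min (shellVolume h ψ₁) (shellVolume h ψ₂) ≤ shellVolume h ψ₃ := by
  have hv := min_volume_le_volume_midpoints (measurableSet_rayBody hn hk1 hk2 hco h₁)
    (measurableSet_rayBody hn hk1 hk2 hco h₂) (measurableSet_rayBody hn hk1 hk2 hco h₃)
    fun a ha b hb => mem_rayBody_of_inner_le hn hk1 hk2 (hmid a ha b hb)
  rw [volume_rayBody hn hk1 hk2 hco h₁ hε₁, volume_rayBody hn hk1 hk2 hco h₂ hε₂,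
    volume_rayBody hn hk1 hk2 hco h₃ hε₃] at hv
  have hfin := (volume_innerBody_lt_top hk2 ε).ne
  have h0 : shellVolume h (fun _ => -ε) ≤ shellVolume h ψ₃ :=
    shellVolume_mono hk2 h₃ continuousOn_const fun u hu => by linarith [hε₃ u hu]
  rw [min_le_iff] at hv ⊢
  refine hv.imp (fun hle => ?_) fun hle => ?_ <;>
  · rw [ENNReal.add_le_add_iff_left hfin, ENNReal.ofReal_le_ofReal_iff (sub_nonneg.2 h0)] at hle
    linarith

end VolumeFormula

section SupportEstimate

variable {n : ℕ}

theorem inner_eq_one_sub_of_unit {u v : E n} (hu : ‖u‖ = 1) (hv : ‖v‖ = 1) :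
    ⟪u, v⟫ = 1 - ‖v - u‖ ^ 2 / 2 := by
  rw [norm_sub_sq_real, hu, hv, real_inner_comm]
  ring

theorem exists_sphere_bounds {φ : E n → ℝ} (hφ : ContDiff ℝ 1 φ) :
    ∃ L > 0, (∀ u ∈ sphere (0 : E n) 1, |φ u| ≤ L) ∧
      (∀ u ∈ sphere (0 : E n) 1, ‖gradient φ u‖ ≤ L) ∧
      ∀ u ∈ sphere (0 : E n) 1, ∀ v ∈ sphere (0 : E n) 1, |φ v - φ u| ≤ L * ‖v - u‖ := by
  obtain ⟨L₁, h₁⟩ := (isCompact_closedBall (0 : E n) 1).exists_bound_of_continuousOn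
    hφ.continuous.continuousOn
  obtain ⟨L₂, h₂⟩ := (isCompact_closedBall (0 : E n) 1).exists_bound_of_continuousOn
    (hφ.continuous_fderiv one_ne_zero).continuousOn
  have hsub := sphere_subset_closedBall (x := (0 : E n)) (ε := 1)
  refine ⟨max (max L₁ L₂) 1, by positivity, fun u hu => ?_, fun u hu => ?_, fun u hu v hv => ?_⟩
  · exact (h₁ u (hsub hu)).trans (by simp)
  · rw [gradient, LinearIsometryEquiv.norm_map]
    exact (h₂ u (hsub hu)).trans (by simp)
  · have h3 := (convex_closedBall (0 : E n) 1).norm_image_sub_le_of_norm_fderiv_le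
      (fun x _ => hφ.differentiable one_ne_zero x) h₂ (hsub hu) (hsub hv)
    refine h3.trans (mul_le_mul_of_nonneg_right ?_ (norm_nonneg _))
    simp

theorem exists_sub_le_inner_gradient {φ : E n → ℝ} (hφ : ContDiff ℝ 1 φ) {κ : ℝ} (hκ : 0 < κ) :
    ∃ ρ > 0, ∀ u ∈ sphere (0 : E n) 1, ∀ v ∈ sphere (0 : E n) 1, ‖v - u‖ ≤ ρ →
      φ v - φ u ≤ ⟪gradient φ u, v - u⟫ + κ * ‖v - u‖ := by
  have huc := (isCompact_closedBall (0 : E n) 1).uniformContinuousOn_of_continuous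
    (hφ.continuous_fderiv one_ne_zero).continuousOn
  obtain ⟨ρ, hρ, hρ'⟩ := Metric.uniformContinuousOn_iff_le.1 huc κ hκ
  have hsub := sphere_subset_closedBall (x := (0 : E n)) (ε := 1)
  refine ⟨ρ, hρ, fun u hu v hv huv => ?_⟩
  have h1 := ((convex_closedBall (0 : E n) 1).inter (convex_closedBall u ρ)
    ).norm_image_sub_le_of_norm_fderiv_le' (f := φ) (φ := fderiv ℝ φ u) (C := κ)
    (x := u) (y := v)
    (fun x _ => hφ.differentiable one_ne_zero x)
    (fun x hx => by
      rw [← dist_eq_norm]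
      exact hρ' x hx.1 u (hsub hu) hx.2)
    ⟨hsub hu, mem_closedBall_self hρ.le⟩ ⟨hsub hv, by rwa [mem_closedBall, dist_eq_norm]⟩
  rw [inner_gradient_eq_fderiv]
  have h2 := (le_abs_self _).trans h1
  linarith

variable {h : E n → ℝ} (hn : 2 ≤ n) (hk1 : homog1 h) (hk2 : ContDiffOn ℝ 2 h {(0 : E n)}ᶜ)

include hk1 hk2 in
theorem exists_support_sub_inner_ge {κ : ℝ} (hκ : 0 < κ) :
    ∃ ρ > 0, ∀ u ∈ sphere (0 : E n) 1, ∀ v ∈ sphere (0 : E n) 1, ‖v - u‖ ≤ ρ →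
      ⟪sHess h u (v - u), v - u⟫ / 2 - κ * ‖v - u‖ ^ 2 ≤ h u - ⟪gradient h v, u⟫ := by
  have hA : IsCompact (closedBall (0 : E n) 1 \ ball 0 (1 / 2)) :=
    (isCompact_closedBall _ _).diff isOpen_ball
  have hA0 : closedBall (0 : E n) 1 \ ball 0 (1 / 2) ⊆ {0}ᶜ := fun x hx h0 => by
    rw [Set.mem_singleton_iff.1 h0] at hx
    exact hx.2 (mem_ball_self (by norm_num))
  have huc := hA.uniformContinuousOn_of_continuous ((continuousOn_sHess hk2).mono hA0)
  obtain ⟨ρ, hρ, hρ'⟩ := Metric.uniformContinuousOn_iff_le.1 huc κ hκ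
  refine ⟨min ρ (1 / 2), by positivity, fun u hu v hv huv => ?_⟩
  have hu1 : ‖u‖ = 1 := by simpa using hu
  have hv1 : ‖v‖ = 1 := by simpa using hv
  have hv0 : v ≠ 0 := fun h0 => by simp [h0] at hv1
  have hseg : ∀ t ∈ Set.Icc (0 : ℝ) 1, ‖v + t • (u - v)‖ ≤ 1 ∧ dist (v + t • (u - v)) u ≤
      ‖v - u‖ := by
    intro t ht
    constructor
    · have h1 : v + t • (u - v) = (1 - t) • v + t • u := by module
      rw [h1]
      refine (norm_add_le _ _).trans ?_
      rw [norm_smul, norm_smul, hu1, hv1, Real.norm_of_nonneg ht.1,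
        Real.norm_of_nonneg (sub_nonneg.2 ht.2)]
      linarith
    · have h1 : v + t • (u - v) - u = (1 - t) • (v - u) := by module
      rw [dist_eq_norm, h1, norm_smul, Real.norm_of_nonneg (sub_nonneg.2 ht.2)]
      exact mul_le_of_le_one_left (norm_nonneg _) (by linarith [ht.1])
  have hmem : ∀ t ∈ Set.Icc (0 : ℝ) 1,
      v + t • (u - v) ∈ closedBall (0 : E n) 1 \ ball 0 (1 / 2) := by
    intro t ht
    obtain ⟨h1, h2⟩ := hseg t ht
    refine ⟨by simpa using h1, ?_⟩
    rw [mem_ball_zero_iff, not_lt]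
    have h3 := norm_sub_norm_le u (v + t • (u - v))
    rw [hu1, ← dist_eq_norm, dist_comm] at h3
    linarith [min_le_right ρ (1 / 2)]
  have hu_mem : u ∈ closedBall (0 : E n) 1 \ ball 0 (1 / 2) := by
    refine ⟨by simp [hu1], ?_⟩
    rw [mem_ball_zero_iff, hu1]; norm_num
  have h4 := segment_ge_of_sHess_ge hk2 (x := v) (y := u)
    (m := ⟪sHess h u (v - u), v - u⟫ - κ * ‖v - u‖ ^ 2) (fun t ht => hA0 (hmem t ht))
    fun t ht => by
      have h5 : ‖sHess h (v + t • (u - v)) - sHess h u‖ ≤ κ := by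
        rw [← dist_eq_norm]
        exact hρ' _ (hmem t ht) u hu_mem
          ((hseg t ht).2.trans (huv.trans (min_le_left _ _)))
      have h6 : |⟪(sHess h (v + t • (u - v)) - sHess h u) (v - u), v - u⟫| ≤ κ * ‖v - u‖ ^ 2 := by
        refine (abs_real_inner_le_norm _ _).trans ?_
        rw [sq, ← mul_assoc]
        refine mul_le_mul_of_nonneg_right ?_ (norm_nonneg _)
        exact (ContinuousLinearMap.le_opNorm _ _).trans
          (mul_le_mul_of_nonneg_right h5 (norm_nonneg _))
      have h7 := (abs_le.1 h6).1
      rw [sub_apply, inner_sub_left] at h7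
      have h8 : ⟪sHess h (v + t • (u - v)) (u - v), u - v⟫ =
          ⟪sHess h (v + t • (u - v)) (v - u), v - u⟫ := by
        rw [← neg_sub v u, map_neg, inner_neg_neg]
      rw [h8]
      linarith
  rw [inner_sub_right, inner_gradient_self hk1 hk2 hv0] at h4
  nlinarith [mul_nonneg hκ.le (sq_nonneg ‖v - u‖)]

/-- The squared length of the tangential gradient of `φ` with respect to the field `N` of
quadratic forms. -/
def tangentEnergy (N : E n → E n →L[ℝ] E n) (φ : E n → ℝ) (u : E n) : ℝ :=
  ⟪N u (tproj u (gradient φ u)), tproj u (gradient φ u)⟫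

variable {ε : ℝ} (hε : 0 < ε)
  (hco : ∀ u : E n, ‖u‖ = 1 → ∀ v, 2 * ε * ‖tproj u v‖ ^ 2 ≤ ⟪sHess h u v, v⟫)
  {N : E n → E n →L[ℝ] E n} (hN : ∀ u ∈ sphere (0 : E n) 1, (sHess h u).comp (N u) = tproj u)

theorem tproj_tproj {u : E n} (hu : ‖u‖ = 1) (v : E n) : tproj u (tproj u v) = tproj u v :=
  tproj_eq_self (inner_tproj_of_unit hu v)

include hk2 hε hco hN in
theorem inner_tproj_gradient_le (φ : E n → ℝ) {u : E n} (hu : ‖u‖ = 1) (δ : ℝ) (w : E n) :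
    δ * ⟪tproj u (gradient φ u), w⟫ ≤
      ⟪sHess h u w, w⟫ / 2 + δ ^ 2 * tangentEnergy N φ u / 2 := by
  have hu0 : u ≠ 0 := fun h0 => by simp [h0] at hu
  set a := tproj u (gradient φ u) with ha
  have h1 : sHess h u (N u a) = a := by
    have := congrArg (fun T => T a) (hN u (by simpa using hu))
    simpa [ha, tproj_tproj hu] using this
  have h2 : 0 ≤ ⟪sHess h u (w - δ • N u a), w - δ • N u a⟫ :=
    le_trans (by positivity) (hco u hu _)
  have h3 : ⟪sHess h u w, N u a⟫ = ⟪w, a⟫ := by rw [inner_sHess_symm hk2 hu0, h1]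
  rw [map_sub, map_smul, h1, inner_sub_left, inner_sub_right, inner_sub_right,
    real_inner_smul_left, real_inner_smul_right, real_inner_smul_left, real_inner_smul_right, h3,
    real_inner_comm a w, real_inner_comm (N u a) a] at h2
  rw [tangentEnergy, ← ha]
  linarith

include hk2 hε hco hN in
theorem tangentEnergy_nonneg (φ : E n → ℝ) {u : E n} (hu : ‖u‖ = 1) : 0 ≤ tangentEnergy N φ u := by
  have := inner_tproj_gradient_le hk2 hε hco hN φ hu 1 0
  simp only [inner_zero_right, mul_zero, map_zero] at this
  linarith

include hn hk1 hk2 hco in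
theorem support_sub_inner_gradient_ge {u v : E n} (hu : ‖u‖ = 1) (hv : ‖v‖ = 1) :
    2 * ε * (1 - ⟪v, u⟫) ≤ h u - ⟪gradient h v, u⟫ := by
  have hu0 : u ≠ 0 := fun h0 => by simp [h0] at hu
  have hv0 : v ≠ 0 := fun h0 => by simp [h0] at hv
  have h1 := inner_gradient_le hn (homog1_sub_norm hk1 (2 * ε)) (contDiffOn_sub_norm hk2 (2 * ε))
    (fun x hx => inner_sHess_sub_norm_nonneg hk1 hk2 le_rfl hco hx) hv0 hu0
  rw [gradient_sub_norm hk2 _ hv0, inner_sub_left, real_inner_smul_left, hu, hv] at h1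
  simp only [inv_one, mul_one] at h1
  linarith

include hn hk1 hk2 hε hco hN in
/-- The support function of `rayBody h ε (δφ)` is at most `h + δφ + δ²(Q/2 + o(1))`. -/
theorem exists_inner_le_of_mem_rayBody {φ : E n → ℝ} (hφ : ContDiff ℝ 1 φ) {η : ℝ} (hη : 0 < η) :
    ∃ δ₀ > 0, ∀ δ, 0 < δ → δ ≤ δ₀ → ∀ x ∈ rayBody h ε (fun u => δ * φ u),
      ∀ u ∈ sphere (0 : E n) 1,
        ⟪x, u⟫ ≤ h u + δ * φ u + δ ^ 2 * (tangentEnergy N φ u / 2 + η) := by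
  obtain ⟨L, hL, hL₁, hL₂, hL₃⟩ := exists_sphere_bounds hφ
  set R := 2 * L / ε with hR
  have hR0 : 0 < R := by positivity
  set κ := η / (2 * (R + R ^ 2)) with hκdef
  have hκ : 0 < κ := by positivity
  have hκR : κ * R ^ 2 + κ * R = η / 2 := by rw [hκdef]; field_simp; ring
  obtain ⟨ρ₁, hρ₁, H₁⟩ := exists_sub_le_inner_gradient hφ hκ
  obtain ⟨ρ₂, hρ₂, H₂⟩ := exists_support_sub_inner_ge hk1 hk2 hκ
  refine ⟨min (min (ε / L) (ρ₁ / R)) (min (ρ₂ / R) (η / (2 * (L * R ^ 2)))), by positivity,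
    fun δ hδ hδ' x hx u hu => ?_⟩
  obtain ⟨⟨hd1, hd2⟩, hd3, hd4⟩ : (δ ≤ ε / L ∧ δ ≤ ρ₁ / R) ∧ δ ≤ ρ₂ / R ∧
      δ ≤ η / (2 * (L * R ^ 2)) := by simpa only [le_min_iff] using hδ'
  rw [le_div_iff₀ (by positivity)] at hd1 hd2 hd3 hd4
  have hu1 : ‖u‖ = 1 := by simpa using hu
  have hQ := tangentEnergy_nonneg hk2 hε hco hN φ hu1
  have hQη : 0 ≤ δ ^ 2 * (tangentEnergy N φ u / 2 + η) := by positivity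
  have hφu := abs_le.1 (hL₁ u hu)
  have hδφu : -(δ * L) ≤ δ * φ u := by
    linarith [mul_le_mul_of_nonneg_left hφu.1 hδ.le]
  rcases hx with hx | ⟨y, ⟨hy0, hy⟩, rfl⟩
  · linarith [hx u hu]
  have hy0' : 0 < ‖y‖ := norm_pos_iff.2 hy0
  set v := ‖y‖⁻¹ • y with hvdef
  have hv1 : ‖v‖ = 1 := by simp [hvdef, norm_smul, hy0'.ne']
  have hv : v ∈ sphere (0 : E n) 1 := by simpa using hv1
  have hyv : y = ‖y‖ • v := by rw [hvdef, smul_smul, mul_inv_cancel₀ hy0'.ne', one_smul]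
  set s := ‖y‖ - ε with hs
  have hs1 : s ≤ δ * φ v := by linarith
  have hs2 : -ε ≤ s := by linarith
  have hφv := abs_le.1 (hL₁ v hv)
  have hval : ⟪rayMap h ε y, u⟫ = ⟪gradient h v, u⟫ + s * ⟪v, u⟫ := by
    rw [hyv, rayMap_smul hk1 hk2 ε hv1 hy0', inner_add_left, real_inner_smul_left]
  rw [hval]
  have hG := support_sub_inner_gradient_ge hn hk1 hk2 hco hu1 hv1
  have hc := inner_eq_one_sub_of_unit hv1 hu1
  rw [norm_sub_rev] at hc
  set d := ‖v - u‖ with hd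
  have hd0 : 0 ≤ d := norm_nonneg _
  rcases lt_or_ge ⟪v, u⟫ 0 with hneg | hnonneg
  · have h1 : s * ⟪v, u⟫ ≤ -ε * ⟪v, u⟫ := mul_le_mul_of_nonpos_right hs2 hneg.le
    have h2 : ε * ⟪v, u⟫ ≤ 0 := mul_nonpos_of_nonneg_of_nonpos hε.le hneg.le
    linarith
  have hsc : s * ⟪v, u⟫ ≤ δ * φ v + δ * L * (d ^ 2 / 2) := by
    have h1 : s * ⟪v, u⟫ ≤ δ * φ v * ⟪v, u⟫ := mul_le_mul_of_nonneg_right hs1 hnonneg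
    rw [hc] at h1 ⊢
    have h2 : -(δ * φ v) * (d ^ 2 / 2) ≤ δ * L * (d ^ 2 / 2) :=
      mul_le_mul_of_nonneg_right
      (by linarith [mul_le_mul_of_nonneg_left hφv.1 hδ.le]) (by positivity)
    linarith
  rcases le_or_gt (R * δ) d with hfar | hnear
  · have h1 : δ * φ v ≤ δ * φ u + δ * (L * d) := by
      have h0 := mul_le_mul_of_nonneg_left ((le_abs_self _).trans (hL₃ u hu v hv)) hδ.le
      linarith
    have h2 : δ * L * (d ^ 2 / 2) ≤ ε * (d ^ 2 / 2) :=
      mul_le_mul_of_nonneg_right hd1 (by positivity)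
    have h3 : ε * (R * δ) = 2 * L * δ := by rw [hR]; field_simp
    have h4 : 2 * L * δ * d ≤ ε * d * d := by
      rw [← h3]
      exact mul_le_mul_of_nonneg_right (mul_le_mul_of_nonneg_left hfar hε.le) hd0
    have h5 : 2 * ε * (1 - ⟪v, u⟫) = ε * d * d := by rw [hc]; ring
    have h6 : ε * (d ^ 2 / 2) = ε * d * d / 2 := by ring
    linarith
  · have h1 := H₁ u hu v hv (by linarith)
    have h2 := H₂ u hu v hv (by linarith)
    have h3 := inner_tproj_gradient_le hk2 hε hco hN φ hu1 δ (v - u)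
    have h4 : ⟪gradient φ u, v - u⟫ =
        ⟪tproj u (gradient φ u), v - u⟫ + ⟪u, gradient φ u⟫ * ⟪u, v - u⟫ := by
      rw [tproj_apply, inner_sub_left, real_inner_smul_left]; ring
    have h5 : ⟪u, v - u⟫ = -(d ^ 2 / 2) := by
      rw [inner_sub_right, real_inner_self_eq_norm_sq, hu1, real_inner_comm, hc]; ring
    have h6 : |⟪u, gradient φ u⟫| ≤ L := by
      refine (abs_real_inner_le_norm _ _).trans ?_
      rw [hu1, one_mul]
      exact hL₂ u hu
    have h7 : ⟪u, gradient φ u⟫ * ⟪u, v - u⟫ ≤ L * (d ^ 2 / 2) := by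
      rw [h5]
      linarith [mul_le_mul_of_nonneg_right (abs_le.1 h6).1 (by positivity : 0 ≤ d ^ 2 / 2)]
    have h8 : d ^ 2 ≤ R ^ 2 * δ ^ 2 := by
      rw [← mul_pow]; exact pow_le_pow_left₀ hd0 hnear.le 2
    have h9 : δ * φ v ≤ δ * (φ u + ⟪tproj u (gradient φ u), v - u⟫ + L * (d ^ 2 / 2) + κ * d) :=
      mul_le_mul_of_nonneg_left (by linarith) hδ.le
    have h10 : δ * (κ * d) ≤ κ * R * δ ^ 2 := by
      linarith [mul_le_mul_of_nonneg_left hnear.le (mul_pos hδ hκ).le]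
    have h11 : κ * d ^ 2 ≤ κ * R ^ 2 * δ ^ 2 := by
      linarith [mul_le_mul_of_nonneg_left h8 hκ.le]
    have h12 : δ * L * d ^ 2 ≤ η / 2 * δ ^ 2 := by
      have h13 : δ * L * d ^ 2 ≤ δ * L * (R ^ 2 * δ ^ 2) :=
        mul_le_mul_of_nonneg_left h8 (by positivity)
      have h14 : δ * (2 * (L * R ^ 2)) * δ ^ 2 ≤ η * δ ^ 2 :=
        mul_le_mul_of_nonneg_right hd4 (by positivity)
      linarith
    have h15 : κ * R ^ 2 * δ ^ 2 + κ * R * δ ^ 2 = η / 2 * δ ^ 2 := by rw [← hκR]; ring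
    linarith

end SupportEstimate

section Poincare

variable {n : ℕ} {h : E n → ℝ} (hn : 2 ≤ n) (hk1 : homog1 h)
  (hk2 : ContDiffOn ℝ 2 h {(0 : E n)}ᶜ)
  (hpos : ∀ u ∈ sphere (0 : E n) 1, ∀ v ∈ (ℝ ∙ u)ᗮ, v ≠ 0 → 0 < ⟪sHess h u v, v⟫)
  {Cof : E n → E n →L[ℝ] E n}
  (hCtan : ∀ u ∈ sphere (0 : E n) 1, ∀ v : E n, Cof u v ∈ (ℝ ∙ u)ᗮ)
  (hCinv : ∀ u ∈ sphere (0 : E n) 1, (sHess h u).comp (Cof u) = sdet h u • tproj u)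

theorem integrable_toSphere_of_continuousOn {f : E n → ℝ}
    (hf : ContinuousOn f (sphere (0 : E n) 1)) :
    Integrable (fun u : sphere (0 : E n) 1 => f u) (volume : Measure (E n)).toSphere :=
  integrable_toSphere_of_continuous hf.domRestrict

include hk1 hk2 hpos hCtan hCinv in
theorem continuousOn_trace_cofactor :
    ContinuousOn (fun u => LinearMap.trace ℝ (E n) (Cof u : E n →ₗ[ℝ] E n))
      (sphere (0 : E n) 1) := by
  have h1 : Continuous fun T : E n →L[ℝ] E n => LinearMap.trace ℝ (E n) (T : E n →ₗ[ℝ] E n) :=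
    ((LinearMap.trace ℝ (E n)).comp
      (ContinuousLinearMap.coeLM ℝ : (E n →L[ℝ] E n) →ₗ[ℝ] E n →ₗ[ℝ] E n)
      ).continuous_of_finiteDimensional
  exact h1.comp_continuousOn (continuousOn_cofactor hk1 hk2 hpos hCtan hCinv)

include hk1 hk2 hpos hCtan hCinv in
theorem exists_abs_shellVolume_sub_le {κ : ℝ} (hκ : 0 < κ) :
    ∃ ρ > 0, ∀ ψ : E n → ℝ, ContinuousOn ψ (sphere (0 : E n) 1) →
      (∀ u ∈ sphere (0 : E n) 1, |ψ u| ≤ ρ) →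
      |shellVolume h ψ - ∫ u : sphere (0 : E n) 1, (sdet h u * ψ u +
        LinearMap.trace ℝ (E n) (Cof u : E n →ₗ[ℝ] E n) * ψ u ^ 2 / 2)
          ∂(volume : Measure (E n)).toSphere| ≤
      κ * ∫ u : sphere (0 : E n) 1, ψ u ^ 2 ∂(volume : Measure (E n)).toSphere := by
  obtain ⟨ρ, hρ, hle⟩ := exists_abs_shiftDet_sub_le hk1 hk2 hpos hCtan hCinv hκ
  refine ⟨ρ, hρ, fun ψ hψ hψρ => ?_⟩
  have htr := continuousOn_trace_cofactor hk1 hk2 hpos hCtan hCinv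
  have hdet := continuousOn_sdet hk2
  rw [shellVolume, ← integral_sub
    (integrable_toSphere_of_continuous (continuous_integral_abs_shiftDet hk2 hψ))
    (integrable_toSphere_of_continuousOn (f := fun u => sdet h u * ψ u +
      LinearMap.trace ℝ (E n) (Cof u : E n →ₗ[ℝ] E n) * ψ u ^ 2 / 2)
      ((hdet.mul hψ).add ((htr.mul (hψ.pow 2)).div_const 2))), ← integral_const_mul,
    ← Real.norm_eq_abs]
  refine norm_integral_le_of_norm_le
    ((integrable_toSphere_of_continuousOn (hψ.pow 2)).const_mul κ) (.of_forall fun u => ?_)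
  set T := LinearMap.trace ℝ (E n) (Cof u : E n →ₗ[ℝ] E n) with hT
  have h1 : ∫ s in (0 : ℝ)..ψ u, (sdet h u + s * T) = sdet h u * ψ u + T * ψ u ^ 2 / 2 := by
    rw [intervalIntegral.integral_add (by simp) (Continuous.intervalIntegrable (by fun_prop) _ _),
      intervalIntegral.integral_const, intervalIntegral.integral_mul_const, integral_id]
    simp only [smul_eq_mul]
    ring
  rw [← h1, ← intervalIntegral.integral_sub (intervalIntegrable_abs_shiftDet hk2 u _ _)
    (Continuous.intervalIntegrable (by fun_prop) _ _)]
  have h2 := intervalIntegral.norm_integral_le_of_norm_le_const (a := 0) (b := ψ u)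
    (f := fun s => |shiftDet h u s| - (sdet h u + s * T)) (C := κ * |ψ u|) fun s hs => by
      have hs' : |s| ≤ |ψ u| := by
        have := Set.abs_sub_left_of_mem_uIcc (Set.uIoc_subset_uIcc hs)
        simpa using this
      exact (hle u u.2 s (hs'.trans (hψρ u u.2))).trans (mul_le_mul_of_nonneg_left hs' hκ.le)
  refine h2.trans_eq ?_
  rw [sub_zero, mul_assoc, ← sq, sq_abs]

theorem tangentEnergy_neg (N : E n → E n →L[ℝ] E n) (φ : E n → ℝ) (u : E n) :
    tangentEnergy N (fun x => -φ x) u = tangentEnergy N φ u := by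
  have : gradient (fun x => -φ x) u = -gradient φ u := by
    rw [gradient, gradient, fderiv_fun_neg, map_neg]
  rw [tangentEnergy, tangentEnergy, this, map_neg, map_neg, inner_neg_neg]

theorem continuous_gradient {φ : E n → ℝ} (hφ : ContDiff ℝ 1 φ) : Continuous (gradient φ) :=
  (InnerProductSpace.toDual ℝ (E n)).symm.continuous.comp (hφ.continuous_fderiv one_ne_zero)

theorem continuousOn_tangentEnergy {N : E n → E n →L[ℝ] E n} {φ : E n → ℝ} (hφ : ContDiff ℝ 1 φ)
    {s : Set (E n)} (hN : ContinuousOn N s) : ContinuousOn (tangentEnergy N φ) s := by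
  have h1 : Continuous fun u => tproj u (gradient φ u) :=
    continuous_tproj.clm_apply (continuous_gradient hφ)
  exact (hN.clm_apply h1.continuousOn).inner h1.continuousOn

include hn hk1 hk2 hpos hCtan hCinv in
theorem eventually_trace_le {φ : E n → ℝ} (hφ : ContDiff ℝ 1 φ)
    (hmean : ∫ u : sphere (0 : E n) 1, φ u * sdet h u ∂(volume : Measure (E n)).toSphere = 0)
    {N : E n → E n →L[ℝ] E n} (hN : ContinuousOn N (sphere (0 : E n) 1))
    (hNinv : ∀ u ∈ sphere (0 : E n) 1, (sHess h u).comp (N u) = tproj u) {η : ℝ} (hη : 0 < η) :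
    ∃ C, ∀ᶠ δ in nhdsWithin (0 : ℝ) (Set.Ioi 0),
      (∫ u : sphere (0 : E n) 1, LinearMap.trace ℝ (E n) (Cof u : E n →ₗ[ℝ] E n) * φ u ^ 2
        ∂(volume : Measure (E n)).toSphere) / 2 -
        η * ∫ u : sphere (0 : E n) 1, φ u ^ 2 ∂(volume : Measure (E n)).toSphere ≤
      (∫ u : sphere (0 : E n) 1, sdet h u * (tangentEnergy N φ u / 2 + η)
        ∂(volume : Measure (E n)).toSphere) + δ ^ 2 * C := by
  set σ := (volume : Measure (E n)).toSphere with hσ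
  set T : E n → ℝ := fun u => LinearMap.trace ℝ (E n) (Cof u : E n →ₗ[ℝ] E n) with hT
  have hTc : ContinuousOn T (sphere (0 : E n) 1) :=
    continuousOn_trace_cofactor hk1 hk2 hpos hCtan hCinv
  have hdet := continuousOn_sdet hk2
  set q : E n → ℝ := fun u => tangentEnergy N φ u / 2 + η with hq
  have hqc : ContinuousOn q (sphere (0 : E n) 1) :=
    ((continuousOn_tangentEnergy hφ hN).div_const 2).add continuousOn_const
  obtain ⟨ε, hε, hco⟩ := exists_coercive hk1 hk2 hpos
  have hco' : ∀ u : E n, ‖u‖ = 1 → ∀ v, ε * ‖tproj u v‖ ^ 2 ≤ ⟪sHess h u v, v⟫ := fun u hu v =>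
    le_trans (by nlinarith [mul_nonneg hε.le (sq_nonneg ‖tproj u v‖)]) (hco u hu v)
  have hq0 : ∀ u ∈ sphere (0 : E n) 1, 0 ≤ q u := fun u hu => by
    have := tangentEnergy_nonneg hk2 hε hco hNinv φ (u := u) (by simpa using hu)
    positivity
  obtain ⟨δ₁, hδ₁, H₁⟩ := exists_inner_le_of_mem_rayBody hn hk1 hk2 hε hco hNinv hφ hη
  obtain ⟨δ₂, hδ₂, H₂⟩ := exists_inner_le_of_mem_rayBody hn hk1 hk2 hε hco hNinv hφ.neg hη
  obtain ⟨ρ, hρ, hexp⟩ := exists_abs_shellVolume_sub_le hk1 hk2 hpos hCtan hCinv hη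
  change ∀ ψ : E n → ℝ, _ → _ → |shellVolume h ψ - ∫ u : sphere (0 : E n) 1,
    (sdet h u * ψ u + T u * ψ u ^ 2 / 2) ∂σ| ≤ η * ∫ u : sphere (0 : E n) 1, ψ u ^ 2 ∂σ at hexp
  obtain ⟨K₁, hK₁⟩ := (isCompact_sphere (0 : E n) 1).exists_bound_of_continuousOn
    hφ.continuous.continuousOn
  obtain ⟨K₂, hK₂⟩ := (isCompact_sphere (0 : E n) 1).exists_bound_of_continuousOn hqc
  set K := max (max K₁ K₂) 1 with hK
  have hK0 : 0 < K := by positivity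
  refine ⟨∫ u : sphere (0 : E n) 1, T u * q u ^ 2 / 2 ∂σ + η * ∫ u : sphere (0 : E n) 1, q u ^ 2 ∂σ,
    ?_⟩
  have hsmall : ∀ c : ℝ, 0 < c → ∀ᶠ δ in nhdsWithin (0 : ℝ) (Set.Ioi 0), δ ≤ c := fun c hc =>
    nhdsWithin_le_nhds (Iic_mem_nhds hc)
  filter_upwards [self_mem_nhdsWithin, hsmall 1 one_pos, hsmall _ hδ₁, hsmall _ hδ₂,
    hsmall _ (div_pos hρ hK0), hsmall _ (div_pos hε hK0)] with δ hδ hd1 hd2 hd3 hd4 hd5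
  have hδ0 : (0 : ℝ) < δ := hδ
  rw [le_div_iff₀ hK0] at hd4 hd5
  have hφK : ∀ u ∈ sphere (0 : E n) 1, |φ u| ≤ K := fun u hu => (hK₁ u hu).trans (by simp [hK])
  have hqK : ∀ u ∈ sphere (0 : E n) 1, |q u| ≤ K := fun u hu => (hK₂ u hu).trans (by simp [hK])
  have hδφ : ∀ u ∈ sphere (0 : E n) 1, |δ * φ u| ≤ δ * K := fun u hu => by
    rw [abs_mul, abs_of_pos hδ0]; exact mul_le_mul_of_nonneg_left (hφK u hu) hδ0.le
  have hδφ' : ∀ u ∈ sphere (0 : E n) 1, |δ * -φ u| ≤ δ * K := fun u hu => by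
    rw [mul_neg, abs_neg]; exact hδφ u hu
  have hδq : ∀ u ∈ sphere (0 : E n) 1, |δ ^ 2 * q u| ≤ δ * K := fun u hu => by
    rw [abs_mul, abs_of_pos (by positivity)]
    exact mul_le_mul (by nlinarith) (hqK u hu) (abs_nonneg _) hδ0.le
  have hφc : ContinuousOn φ (sphere (0 : E n) 1) := hφ.continuous.continuousOn
  have c₁ : ContinuousOn (fun u => δ * φ u) (sphere (0 : E n) 1) := continuousOn_const.mul hφc
  have c₂ : ContinuousOn (fun u => δ * -φ u) (sphere (0 : E n) 1) := continuousOn_const.mul hφc.neg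
  have c₃ : ContinuousOn (fun u => δ ^ 2 * q u) (sphere (0 : E n) 1) := continuousOn_const.mul hqc
  have hmin := min_shellVolume_le hn hk1 hk2 hco' c₁ c₂ c₃
    (fun u hu => by linarith [(abs_le.1 (hδφ u hu)).1])
    (fun u hu => by linarith [(abs_le.1 (hδφ' u hu)).1])
    (fun u hu => by have := hq0 u hu; positivity) fun a ha b hb u hu => by
      have h1 := H₁ δ hδ0 hd2 a ha u hu
      have h2 := H₂ δ hδ0 hd3 b hb u hu
      simp only [tangentEnergy_neg] at h2
      rw [real_inner_smul_left, inner_add_left]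
      simp only [hq]
      linarith
  have e₁ := abs_le.1 (hexp _ c₁ fun u hu => (hδφ u hu).trans hd4)
  have e₂ := abs_le.1 (hexp _ c₂ fun u hu => (hδφ' u hu).trans hd4)
  have e₃ := abs_le.1 (hexp _ c₃ fun u hu => (hδq u hu).trans hd4)
  have iφ : Integrable (fun u : sphere (0 : E n) 1 => φ u * sdet h u) σ :=
    integrable_toSphere_of_continuousOn (hφc.mul hdet)
  have iT : Integrable (fun u : sphere (0 : E n) 1 => T u * φ u ^ 2) σ :=
    integrable_toSphere_of_continuousOn (hTc.mul (hφc.pow 2))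
  have iq : Integrable (fun u : sphere (0 : E n) 1 => sdet h u * q u) σ :=
    integrable_toSphere_of_continuousOn (hdet.mul hqc)
  have iTq : Integrable (fun u : sphere (0 : E n) 1 => T u * q u ^ 2 / 2) σ :=
    integrable_toSphere_of_continuousOn ((hTc.mul (hqc.pow 2)).div_const 2)
  have hexpand : ∀ c : ℝ, (∫ u : sphere (0 : E n) 1, (c * (φ u * sdet h u) +
      δ ^ 2 / 2 * (T u * φ u ^ 2)) ∂σ) =
        δ ^ 2 / 2 * ∫ u : sphere (0 : E n) 1, T u * φ u ^ 2 ∂σ := by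
    intro c
    rw [integral_add (iφ.const_mul c) (iT.const_mul (δ ^ 2 / 2)), integral_const_mul,
      integral_const_mul, hmean, mul_zero, zero_add]
  have f₁ : ∫ u : sphere (0 : E n) 1, (sdet h u * (δ * φ u) + T u * (δ * φ u) ^ 2 / 2) ∂σ =
      δ ^ 2 / 2 * ∫ u : sphere (0 : E n) 1, T u * φ u ^ 2 ∂σ := by
    rw [← hexpand δ]
    exact integral_congr_ae (.of_forall fun u => by ring)
  have f₂ : ∫ u : sphere (0 : E n) 1, (sdet h u * (δ * -φ u) + T u * (δ * -φ u) ^ 2 / 2) ∂σ =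
      δ ^ 2 / 2 * ∫ u : sphere (0 : E n) 1, T u * φ u ^ 2 ∂σ := by
    rw [← hexpand (-δ)]
    exact integral_congr_ae (.of_forall fun u => by ring)
  have f₃ : ∫ u : sphere (0 : E n) 1, (sdet h u * (δ ^ 2 * q u) + T u * (δ ^ 2 * q u) ^ 2 / 2) ∂σ =
      δ ^ 2 * ∫ u : sphere (0 : E n) 1, sdet h u * q u ∂σ +
      δ ^ 4 * ∫ u : sphere (0 : E n) 1, T u * q u ^ 2 / 2 ∂σ := by
    rw [← integral_const_mul, ← integral_const_mul,
      ← integral_add (iq.const_mul (δ ^ 2)) (iTq.const_mul (δ ^ 4))]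
    exact integral_congr_ae (.of_forall fun u => by ring)
  have g₁ : ∫ u : sphere (0 : E n) 1, (δ * φ u) ^ 2 ∂σ =
      δ ^ 2 * ∫ u : sphere (0 : E n) 1, φ u ^ 2 ∂σ := by
    simp only [mul_pow, integral_const_mul]
  have g₂ : ∫ u : sphere (0 : E n) 1, (δ * -φ u) ^ 2 ∂σ =
      δ ^ 2 * ∫ u : sphere (0 : E n) 1, φ u ^ 2 ∂σ := by
    simp only [mul_pow, neg_sq, integral_const_mul]
  have g₃ : ∫ u : sphere (0 : E n) 1, (δ ^ 2 * q u) ^ 2 ∂σ =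
      δ ^ 4 * ∫ u : sphere (0 : E n) 1, q u ^ 2 ∂σ := by
    simp only [mul_pow, ← pow_mul, integral_const_mul]
  rw [f₁, g₁] at e₁
  rw [f₂, g₂] at e₂
  rw [f₃, g₃] at e₃
  have hfinal : δ ^ 2 / 2 * ∫ u : sphere (0 : E n) 1, T u * φ u ^ 2 ∂σ -
      η * (δ ^ 2 * ∫ u : sphere (0 : E n) 1, φ u ^ 2 ∂σ) ≤ shellVolume h fun u => δ ^ 2 * q u :=
    (le_min (by linarith) (by linarith)).trans hmin
  refine le_of_mul_le_mul_left ?_ (by positivity : 0 < δ ^ 2)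
  linarith [hfinal.trans (sub_le_iff_le_add.1 e₃.2)]

include hn hk1 hk2 hpos hCtan hCinv in
theorem integral_toSphere_trace_le {φ : E n → ℝ} (hφ : ContDiff ℝ 1 φ)
    (hmean : ∫ u : sphere (0 : E n) 1, φ u * sdet h u ∂(volume : Measure (E n)).toSphere = 0) :
    ∫ u : sphere (0 : E n) 1, LinearMap.trace ℝ (E n) (Cof u : E n →ₗ[ℝ] E n) * φ u ^ 2
        ∂(volume : Measure (E n)).toSphere ≤
      ∫ u : sphere (0 : E n) 1, tangentEnergy Cof φ u ∂(volume : Measure (E n)).toSphere := by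
  set σ := (volume : Measure (E n)).toSphere with hσ
  have hdet := continuousOn_sdet hk2
  have hCof := continuousOn_cofactor hk1 hk2 hpos hCtan hCinv
  have hd0 : ∀ u ∈ sphere (0 : E n) 1, sdet h u ≠ 0 := fun u hu =>
    (sdet_pos hk1 hk2 hpos (by simpa using hu)).ne'
  set N : E n → E n →L[ℝ] E n := fun u => (sdet h u)⁻¹ • Cof u with hNdef
  have hN : ContinuousOn N (sphere (0 : E n) 1) := (hdet.inv₀ hd0).smul hCof
  have hNinv : ∀ u ∈ sphere (0 : E n) 1, (sHess h u).comp (N u) = tproj u := fun u hu => by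
    simp only [hNdef]
    rw [ContinuousLinearMap.comp_smul, hCinv u hu, inv_smul_smul₀ (hd0 u hu)]
  have hQ : ∀ u ∈ sphere (0 : E n) 1, sdet h u * tangentEnergy N φ u = tangentEnergy Cof φ u := by
    intro u hu
    simp only [tangentEnergy, hNdef, smul_apply, real_inner_smul_left]
    rw [mul_inv_cancel_left₀ (hd0 u hu)]
  have hsum : ∀ η : ℝ, ∫ u : sphere (0 : E n) 1, sdet h u * (tangentEnergy N φ u / 2 + η) ∂σ =
      (∫ u : sphere (0 : E n) 1, tangentEnergy Cof φ u ∂σ) / 2 +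
        η * ∫ u : sphere (0 : E n) 1, sdet h u ∂σ := by
    intro η
    rw [← integral_div, ← integral_const_mul, ← integral_add
      ((integrable_toSphere_of_continuousOn (continuousOn_tangentEnergy hφ hCof)).div_const 2)
      ((integrable_toSphere_of_continuousOn hdet).const_mul η)]
    refine integral_congr_ae (.of_forall fun u => ?_)
    simp only [← hQ u u.2]
    ring
  set A := ∫ u : sphere (0 : E n) 1, LinearMap.trace ℝ (E n) (Cof u : E n →ₗ[ℝ] E n) * φ u ^ 2 ∂σ
  set P := ∫ u : sphere (0 : E n) 1, φ u ^ 2 ∂σ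
  set G := ∫ u : sphere (0 : E n) 1, tangentEnergy Cof φ u ∂σ
  set D := ∫ u : sphere (0 : E n) 1, sdet h u ∂σ
  have hkey : ∀ η : ℝ, 0 < η → A / 2 - η * P ≤ G / 2 + η * D := by
    intro η hη
    obtain ⟨C, hC⟩ := eventually_trace_le hn hk1 hk2 hpos hCtan hCinv hφ hmean hN hNinv hη
    rw [hsum η] at hC
    have hlim : Filter.Tendsto (fun δ : ℝ => G / 2 + η * D + δ ^ 2 * C)
        (nhdsWithin 0 (Set.Ioi 0)) (nhds (G / 2 + η * D + 0 ^ 2 * C)) :=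
      (Continuous.tendsto (by fun_prop) 0).mono_left nhdsWithin_le_nhds
    simpa using ge_of_tendsto hlim hC
  have hlim : Filter.Tendsto (fun η : ℝ => G / 2 + η * D + η * P)
      (nhdsWithin 0 (Set.Ioi 0)) (nhds (G / 2 + 0 * D + 0 * P)) :=
    (Continuous.tendsto (by fun_prop) 0).mono_left nhdsWithin_le_nhds
  have := ge_of_tendsto (b := A / 2) hlim (by
    filter_upwards [self_mem_nhdsWithin] with η hη
    linarith [hkey η hη])
  linarith

end Poincare

/-- Theorem 3.1 (Theorem `T2` of the paper):  Let `h ∈ 𝒞` and let `(c_ij)` be the cofactor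
matrix of `(h_ij + h δ_ij)`; it is represented by the field of endomorphisms `Cof u`
characterized by: `Cof u` takes values in the tangent space `u^⊥` and
`(sHess h u) ∘ (Cof u) = det(h_ij + h δ_ij)(u) • tproj u`.
If `φ ∈ C¹(S^{n-1})` (represented by a `C¹` extension) satisfies
`∫_{S^{n-1}} φ det(h_ij + h δ_ij) dℋ^{n-1} = 0`, then
`∫ tr(c_ij) φ² dℋ^{n-1} ≤ ∫ Σ_{i,j} c_ij φ_i φ_j dℋ^{n-1}`,
where `Σ_{i,j} c_ij φ_i φ_j = ⟨Cof u (∇φ), ∇φ⟩` with `∇φ` the tangential gradient of `φ`. -/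
theorem cofactor_poincare
    {n : ℕ} (hn : 2 ≤ n) (h : E n → ℝ) (hh : memC n h)
    (φ : E n → ℝ) (hφ : ContDiff ℝ 1 φ)
    (Cof : E n → E n →L[ℝ] E n)
    (hCtan : ∀ u ∈ sphere (0 : E n) 1, ∀ v : E n, Cof u v ∈ (ℝ ∙ u)ᗮ)
    (hCinv : ∀ u ∈ sphere (0 : E n) 1, (sHess h u).comp (Cof u) = sdet h u • tproj u)
    (hmean : (∫ u in sphere (0 : E n) 1, φ u * sdet h u ∂μH[(n : ℝ) - 1]) = 0) :
    (∫ u in sphere (0 : E n) 1,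
        (LinearMap.trace ℝ (E n) ((Cof u : E n →ₗ[ℝ] E n))) * (φ u) ^ 2 ∂μH[(n : ℝ) - 1])
      ≤ ∫ u in sphere (0 : E n) 1,
          ⟪Cof u (tproj u (gradient φ u)), tproj u (gradient φ u)⟫ ∂μH[(n : ℝ) - 1] := by
  obtain ⟨hk1, hk2, hpos⟩ := hh
  obtain ⟨c, hc, hcf⟩ := exists_setIntegral_sphere_hausdorffMeasure_eq (n := n) (by omega)
  rw [hcf] at hmean
  rw [hcf, hcf]
  rcases mul_eq_zero.1 hmean with rfl | hmean
  · simp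
  · exact mul_le_mul_of_nonneg_left
      (integral_toSphere_trace_le hn hk1 hk2 hpos hCtan hCinv hφ hmean) hc
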